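/- Let R be a Gorenstein local ring and let a and b be perfect Gorenstein ideals of R. Assume M ∈ CM^n(R), X ∈ CM^m(R), M ∼_a N, and X ∼_b Y. Then: (i) Êxt^i_R(M,X) ≅ Êxt^{i+m−n}_R(Y,N) for all i ∈ ℤ; (ii) in particular Êxt^i_R(M,M) ≅ Êxt^i_R(N,N) for all i ∈ ℤ; (iii) if M and X are self-linked (M ∼_a M and X ∼_b X), then Êxt^i_R(M,X) ≅ Êxt^{i+m−n}_R(X,M) for all i ∈ ℤ. -/

import Mathlib

open CategoryTheory CategoryTheory.Limits CategoryTheory.MonoidalCategory Opposite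

noncomputable section

universe u

variable (R : Type u) [CommRing R]

/-- Ordinary `Ext` of `R`-modules, via the derived functor `Ext` of Mathlib. -/
abbrev ExtMod (n : ℕ) (M N : ModuleCat.{u} R) : ModuleCat.{u} R :=
  ((Ext R (ModuleCat.{u} R) n).obj (op M)).obj N

/-- Ordinary `Tor` of `R`-modules, via the derived functor `Tor` of Mathlib. -/
abbrev TorMod (n : ℕ) (M N : ModuleCat.{u} R) : ModuleCat.{u} R :=
  ((Tor (ModuleCat.{u} R) n).obj M).obj N

/-- A finitely generated module `M` is totally reflexive (of G-dimension zero) if the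
biduality map is an isomorphism and `Ext^i(M,R) = 0 = Ext^i(M^*,R)` for all `i > 0`. -/
def IsTotallyReflexive (M : ModuleCat.{u} R) : Prop :=
  Module.Finite R M ∧
  Function.Bijective (Module.Dual.eval R M) ∧
  (∀ i : ℕ, 0 < i → IsZero (ExtMod R i M (ModuleCat.of R R))) ∧
  (∀ i : ℕ, 0 < i → IsZero (ExtMod R i (ModuleCat.of R (Module.Dual R M)) (ModuleCat.of R R)))

/-- `M` admits a resolution `0 → G_n → ⋯ → G_0 → M → 0` by totally reflexive modules. -/
def GDimLE (M : ModuleCat.{u} R) (n : ℕ) : Prop :=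
  ∃ (G : ChainComplex (ModuleCat.{u} R) ℕ) (ε : G.X 0 ⟶ M),
    (∀ i, i ≤ n → IsTotallyReflexive R (G.X i)) ∧
    (∀ i, n < i → IsZero (G.X i)) ∧
    Epi ε ∧
    (∃ w : G.d 1 0 ≫ ε = 0, (ShortComplex.mk (G.d 1 0) ε w).Exact) ∧
    (∀ i, 0 < i → G.ExactAt i)

/-- `M` has finite Gorenstein dimension. -/
def HasFiniteGDim (M : ModuleCat.{u} R) : Prop := ∃ n, GDimLE R M n

/-- The Gorenstein dimension of `M`, as an element of `ℕ∞`. -/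
def gdim (M : ModuleCat.{u} R) : ℕ∞ :=
  sInf {c : ℕ∞ | ∃ n : ℕ, c = n ∧ GDimLE R M n}

/-- `M` admits a projective resolution of length at most `n`. -/
def PdLE (M : ModuleCat.{u} R) (n : ℕ) : Prop :=
  ∃ (G : ChainComplex (ModuleCat.{u} R) ℕ) (ε : G.X 0 ⟶ M),
    (∀ i, Projective (G.X i)) ∧
    (∀ i, n < i → IsZero (G.X i)) ∧
    Epi ε ∧
    (∃ w : G.d 1 0 ≫ ε = 0, (ShortComplex.mk (G.d 1 0) ε w).Exact) ∧
    (∀ i, 0 < i → G.ExactAt i)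

/-- `M` has finite projective dimension. -/
def HasFinitePd (M : ModuleCat.{u} R) : Prop := ∃ n, PdLE R M n

/-- The projective dimension of `M`, as an element of `ℕ∞`. -/
def pdim (M : ModuleCat.{u} R) : ℕ∞ :=
  sInf {c : ℕ∞ | ∃ n : ℕ, c = n ∧ PdLE R M n}

/-- `M` admits an injective resolution `0 → M → I^0 → ⋯ → I^n → 0`. -/
def InjDimLE (M : ModuleCat.{u} R) (n : ℕ) : Prop :=
  ∃ (I : CochainComplex (ModuleCat.{u} R) ℕ) (ι : M ⟶ I.X 0),
    (∀ i, Injective (I.X i)) ∧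
    (∀ i, n < i → IsZero (I.X i)) ∧
    Mono ι ∧
    (∃ w : ι ≫ I.d 0 1 = 0, (ShortComplex.mk ι (I.d 0 1) w).Exact) ∧
    (∀ i, 0 < i → I.ExactAt i)

/-- `M` has finite injective dimension. -/
def HasFiniteInjDim (M : ModuleCat.{u} R) : Prop := ∃ n, InjDimLE R M n

/-- A Gorenstein local ring: a commutative Noetherian local ring of finite self-injective
dimension. -/
def IsGorensteinLocalRing : Prop :=
  IsLocalRing R ∧ IsNoetherianRing R ∧ HasFiniteInjDim R (ModuleCat.of R R)

/-- The grade of a module: `grade M = inf { i | Ext^i(M,R) ≠ 0 }`. -/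
def gradeM (M : ModuleCat.{u} R) : ℕ∞ :=
  sInf {c : ℕ∞ | ∃ i : ℕ, c = i ∧ ¬ IsZero (ExtMod R i M (ModuleCat.of R R))}

/-- A module is G-perfect if its grade equals its Gorenstein dimension. -/
def IsGPerfect (M : ModuleCat.{u} R) : Prop := gradeM R M = gdim R M

/-- An ideal `c` is perfect if `grade (R/c) = pd (R/c)`. -/
def IsPerfectIdeal (c : Ideal R) : Prop :=
  gradeM R (ModuleCat.of R (R ⧸ c)) = pdim R (ModuleCat.of R (R ⧸ c))

/-- A complete resolution `T → P → M` of `M`: `P → M` is a resolution by finite projective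
modules, `T` is a totally acyclic complex of finite projective modules, and `θ i` is an
isomorphism for all `i ≫ 0`. -/
structure CompleteResolution (M : ModuleCat.{u} R) where
  T : ChainComplex (ModuleCat.{u} R) ℤ
  P : ChainComplex (ModuleCat.{u} R) ℤ
  θ : T ⟶ P
  π : P.X 0 ⟶ M
  projT : ∀ i, Projective (T.X i)
  fgT : ∀ i, Module.Finite R (T.X i)
  projP : ∀ i, Projective (P.X i)
  fgP : ∀ i, Module.Finite R (P.X i)
  zeroP : ∀ i : ℤ, i < 0 → IsZero (P.X i)
  epiπ : Epi π
  wπ : P.d 1 0 ≫ π = 0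
  exact0 : (ShortComplex.mk (P.d 1 0) π wπ).Exact
  exactP : ∀ i : ℤ, 0 < i → P.ExactAt i
  exactT : ∀ i : ℤ, T.ExactAt i
  exactTdual : ∀ i : ℤ, (T.linearYonedaObj R (ModuleCat.of R R)).ExactAt i
  iso_eventually : ∃ n₀ : ℤ, ∀ i : ℤ, n₀ ≤ i → IsIso (θ.f i)

/-- Tate cohomology `Êxt^i(M,N) = H^i(Hom(T,N))` computed from a complete resolution of `M`. -/
def TateExt {M : ModuleCat.{u} R} (C : CompleteResolution R M) (N : ModuleCat.{u} R)
    (i : ℤ) : ModuleCat.{u} R :=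
  (C.T.linearYonedaObj R N).homology i

/-- Tate homology `T̂or_i(M,N) = H_i(T ⊗ N)` computed from a complete resolution of `M`. -/
def TateTor {M : ModuleCat.{u} R} (C : CompleteResolution R M) (N : ModuleCat.{u} R)
    (i : ℤ) : ModuleCat.{u} R :=
  ((((tensoringRight (ModuleCat.{u} R)).obj N).mapHomologicalComplex _).obj C.T).homology i

/-- The depth of a module over a local ring: the supremum of the lengths of the
`M`-regular sequences contained in the maximal ideal. -/
def moduleDepth [IsLocalRing R] (M : Type u) [AddCommGroup M] [Module R M] : ℕ∞ :=
  sSup {c : ℕ∞ | ∃ rs : List R, c = rs.length ∧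
    (∀ r ∈ rs, r ∈ IsLocalRing.maximalIdeal R) ∧ RingTheory.Sequence.IsRegular M rs}

/-- `E` is an injective envelope of the residue field `k`: an injective module which is an
essential extension of `k`. -/
def IsInjectiveEnvelopeOfResidueField [IsLocalRing R] (E : Type u) [AddCommGroup E]
    [Module R E] : Prop :=
  Injective (ModuleCat.of R E) ∧
  ∃ ι : IsLocalRing.ResidueField R →ₗ[R] E,
    Function.Injective ι ∧
    ∀ N : Submodule R E, N ≠ ⊥ → N ⊓ LinearMap.range ι ≠ ⊥


/-- A minimal free resolution `⋯ → F_1 → F_0 → M → 0` of a finitely generated module over a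
local ring, recorded by its Betti numbers `b n` and differentials with image inside
`m • F_n`. -/
structure MinFreeRes [IsLocalRing R] (M : Type u) [AddCommGroup M] [Module R M] where
  b : ℕ → ℕ
  d : ∀ n : ℕ, ((Fin (b (n+1)) → R) →ₗ[R] (Fin (b n) → R))
  aug : (Fin (b 0) → R) →ₗ[R] M
  aug_surj : Function.Surjective aug
  exact_zero : LinearMap.ker aug = LinearMap.range (d 0)
  exact_succ : ∀ n, LinearMap.ker (d n) = LinearMap.range (d (n+1))
  minimal : ∀ n, LinearMap.range (d n) ≤ (IsLocalRing.maximalIdeal R) • ⊤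

/-- The Betti numbers of `M` are eventually bounded by `γ · n^(c-1)`. -/
def CxLE [IsLocalRing R] (M : Type u) [AddCommGroup M] [Module R M] (c : ℕ) : Prop :=
  ∃ (F : MinFreeRes R M) (γ : ℝ) (n₀ : ℕ),
    ∀ n : ℕ, n₀ ≤ n → (F.b n : ℝ) ≤ γ * (n : ℝ) ^ ((c : ℤ) - 1)

/-- The complexity of a module: the least `c` such that the Betti numbers are eventually
bounded by `γ · n^(c-1)` for some `γ`. -/
def complexity [IsLocalRing R] (M : Type u) [AddCommGroup M] [Module R M] : ℕ∞ :=
  sInf {e : ℕ∞ | ∃ c : ℕ, e = c ∧ CxLE R M c}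

/-- The pushout `K_η` of a map `f : Ω^{j+1} M → M` (representing a degree-`(j+1)`
homogeneous element `η` of `Ext^*(M,M)`) along the inclusion `Ω^{j+1} M ↪ F_j`: the
cokernel of `(f, -incl) : Ω^{j+1} M → M ⊕ F_j`. -/
abbrev PushoutMod [IsLocalRing R] {M : Type u} [AddCommGroup M] [Module R M]
    (F : MinFreeRes R M) (j : ℕ) (f : LinearMap.range (F.d j) →ₗ[R] M) : Type u :=
  (M × (Fin (F.b j) → R)) ⧸
    LinearMap.range (LinearMap.prod f (-(LinearMap.range (F.d j)).subtype))

/-- Auxiliary predicate: `M` has reducible complexity, with recursion depth `≤ c`. -/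
def RedCxAux [IsLocalRing R] :
    ℕ → ∀ (M : Type u) (_ : AddCommGroup M) (_ : Module R M), Prop
  | 0, M, g, m =>
      letI := g; letI := m
      HasFinitePd R (ModuleCat.of R M)
  | (c+1), M, g, m =>
      letI := g; letI := m
      HasFinitePd R (ModuleCat.of R M) ∨
      (complexity R M < ⊤ ∧ 0 < complexity R M ∧
        ∃ (j : ℕ) (F : MinFreeRes R M) (f : LinearMap.range (F.d j) →ₗ[R] M),
          complexity R (PushoutMod R F j f) < complexity R M ∧
          moduleDepth R (PushoutMod R F j f) = moduleDepth R M ∧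
          RedCxAux c (PushoutMod R F j f) inferInstance inferInstance)

/-- `M` has reducible complexity. -/
def HasReducibleComplexity [IsLocalRing R] (M : Type u) [AddCommGroup M] [Module R M] :
    Prop :=
  ∃ c : ℕ, RedCxAux R c M inferInstance inferInstance

/-- `L` is (isomorphic to) `λ N = Ω Tr N`, computed from a minimal free presentation of `N`
over the local ring `S`. -/
def IsLambdaOf (S : Type u) [CommRing S] [IsLocalRing S]
    (N L : Type u) [AddCommGroup N] [Module S N] [AddCommGroup L] [Module S L] : Prop :=
  ∃ (n₀ n₁ : ℕ) (g : (Fin n₀ → S) →ₗ[S] N) (f : (Fin n₁ → S) →ₗ[S] (Fin n₀ → S)),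
    Function.Surjective g ∧
    LinearMap.range f = LinearMap.ker g ∧
    LinearMap.ker g ≤ (IsLocalRing.maximalIdeal S) • ⊤ ∧
    LinearMap.ker f ≤ (IsLocalRing.maximalIdeal S) • ⊤ ∧
    Nonempty (L ≃ₗ[S] LinearMap.range f.dualMap)

/-- `M` and `N` are linked by the ideal `c`: both are annihilated by `c` (hence are
`R/c`-modules) and `M ≅ λ_{R/c} N`, `N ≅ λ_{R/c} M`. -/
def LinkedBy (c : Ideal R) (M N : Type u) [AddCommGroup M] [Module (R ⧸ c) M]
    [AddCommGroup N] [Module (R ⧸ c) N] [IsLocalRing (R ⧸ c)] : Prop :=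
  IsLambdaOf (R ⧸ c) N M ∧ IsLambdaOf (R ⧸ c) M N

section ExtGroups

variable {R : Type u} [CommRing R]

/-- `Ext` groups of unbundled modules. -/
abbrev EMod (R : Type u) [CommRing R] (A V : Type u) [AddCommGroup A] [Module R A]
    [AddCommGroup V] [Module R V] (i : ℕ) : Type u :=
  Abelian.Ext (ModuleCat.of R A) (ModuleCat.of R V) i

variable {A B C D V V' : Type u} [AddCommGroup A] [Module R A] [AddCommGroup B] [Module R B]
  [AddCommGroup C] [Module R C] [AddCommGroup D] [Module R D] [AddCommGroup V] [Module R V]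
  [AddCommGroup V'] [Module R V']

/-- Contravariant functoriality of `Ext`. -/
def extPre (f : A →ₗ[R] B) (V : Type u) [AddCommGroup V] [Module R V] (i : ℕ) :
    EMod R B V i →ₗ[R] EMod R A V i :=
  (Abelian.Ext.mk₀ (ModuleCat.ofHom f)).precompOfLinear R (ModuleCat.of R V) (zero_add i)

lemma extPre_apply (f : A →ₗ[R] B) (i : ℕ) (x : EMod R B V i) :
    extPre f V i x = (Abelian.Ext.mk₀ (ModuleCat.ofHom f)).comp x (zero_add i) := rfl

lemma extPre_id (i : ℕ) (x : EMod R A V i) : extPre (LinearMap.id : A →ₗ[R] A) V i x = x := by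
  rw [extPre_apply]; exact Abelian.Ext.mk₀_id_comp x

lemma extPre_extPre (f : A →ₗ[R] B) (g : B →ₗ[R] C) (i : ℕ) (x : EMod R C V i) :
    extPre f V i (extPre g V i x) = extPre (g ∘ₗ f) V i x := by
  rw [extPre_apply, extPre_apply, Abelian.Ext.mk₀_comp_mk₀_assoc]; rfl

lemma extPre_add (f g : A →ₗ[R] B) (i : ℕ) (x : EMod R B V i) :
    extPre (f + g) V i x = extPre f V i x + extPre g V i x := by
  simp only [extPre_apply, ← Abelian.Ext.add_comp, ← Abelian.Ext.mk₀_add]; rfl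

lemma extPre_smul (r : R) (f : A →ₗ[R] B) (i : ℕ) (x : EMod R B V i) :
    extPre (r • f) V i x = r • extPre f V i x := by
  simp only [extPre_apply, ← Abelian.Ext.smul_comp, ← Abelian.Ext.mk₀_smul]; rfl

lemma extPre_zero (i : ℕ) (x : EMod R B V i) :
    extPre (0 : A →ₗ[R] B) V i x = 0 := by
  have := extPre_smul (0 : R) (0 : A →ₗ[R] B) i x
  simpa using this

lemma extPre_sum {ι : Type*} (s : Finset ι) (f : ι → A →ₗ[R] B) (i : ℕ) (x : EMod R B V i) :
    extPre (∑ j ∈ s, f j) V i x = ∑ j ∈ s, extPre (f j) V i x := by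
  classical
  induction s using Finset.induction_on with
  | empty => simp [extPre_zero]
  | insert a s ha ih => rw [Finset.sum_insert ha, Finset.sum_insert ha, extPre_add, ih]

/-- Isomorphic modules have isomorphic `Ext`. -/
def extCongr (e : A ≃ₗ[R] B) (V : Type u) [AddCommGroup V] [Module R V] (i : ℕ) :
    EMod R B V i ≃ₗ[R] EMod R A V i :=
  LinearEquiv.ofLinearMap (extPre e.toLinearMap V i) (extPre e.symm.toLinearMap V i)
    (by ext x; simp [extPre_extPre, extPre_id]) (by ext x; simp [extPre_extPre, extPre_id])

/-- `Ext` in degree zero is `Hom`. -/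
def extZero (A V : Type u) [AddCommGroup A] [Module R A] [AddCommGroup V] [Module R V] :
    EMod R A V 0 ≃ₗ[R] (A →ₗ[R] V) :=
  (Abelian.Ext.linearEquiv₀ (R := R)).trans ModuleCat.homLinearEquiv

lemma extZero_symm_apply (φ : A →ₗ[R] V) :
    (extZero A V).symm φ = Abelian.Ext.mk₀ (ModuleCat.ofHom φ) := rfl

lemma extPre_extZero_symm (f : A →ₗ[R] B) (φ : B →ₗ[R] V) :
    extPre f V 0 ((extZero B V).symm φ) = (extZero A V).symm (φ ∘ₗ f) := by
  rw [extZero_symm_apply, extZero_symm_apply, extPre_apply, Abelian.Ext.mk₀_comp_mk₀]; rfl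

lemma extZero_extPre (f : A →ₗ[R] B) (x : EMod R B V 0) :
    extZero A V (extPre f V 0 x) = extZero B V x ∘ₗ f := by
  obtain ⟨φ, rfl⟩ := (extZero B V).symm.surjective x
  rw [extPre_extZero_symm]; simp

lemma subsingleton_ext_zero_iff :
    Subsingleton (EMod R A V 0) ↔ Subsingleton (A →ₗ[R] V) :=
  (extZero A V).toEquiv.subsingleton_congr

/-- A short exact sequence of modules. -/
structure SES (f : A →ₗ[R] B) (g : B →ₗ[R] C) : Prop where
  inj : Function.Injective f
  exact : Function.Exact f g
  surj : Function.Surjective g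

lemma SES.comp_eq_zero {f : A →ₗ[R] B} {g : B →ₗ[R] C} (h : SES f g) : g ∘ₗ f = 0 :=
  h.exact.linearMap_comp_eq_zero

lemma SES.apply_apply {f : A →ₗ[R] B} {g : B →ₗ[R] C} (h : SES f g) (x : A) : g (f x) = 0 :=
  h.exact.apply_apply_eq_zero x

lemma SES.range_eq {f : A →ₗ[R] B} {g : B →ₗ[R] C} (h : SES f g) :
    LinearMap.range f = LinearMap.ker g := h.exact.linearMap_ker_eq.symm

lemma SES.ker (g : B →ₗ[R] C) (hg : Function.Surjective g) : SES (LinearMap.ker g).subtype g :=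
  ⟨Subtype.val_injective, LinearMap.exact_subtype_ker_map g, hg⟩

/-- The short complex underlying a short exact sequence. -/
def SES.cx {f : A →ₗ[R] B} {g : B →ₗ[R] C} (h : SES f g) : ShortComplex (ModuleCat.{u} R) :=
  ShortComplex.mk (ModuleCat.ofHom f) (ModuleCat.ofHom g) (by
    rw [← ModuleCat.ofHom_comp, h.comp_eq_zero]; rfl)

lemma SES.shortExact {f : A →ₗ[R] B} {g : B →ₗ[R] C} (h : SES f g) : h.cx.ShortExact where
  exact := (ShortComplex.ShortExact.moduleCat_exact_iff_function_exact _).mpr h.exact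
  mono_f := (ModuleCat.mono_iff_injective _).mpr h.inj
  epi_g := (ModuleCat.epi_iff_surjective _).mpr h.surj

/-- The connecting map of the contravariant long exact sequence. -/
def SES.δ {f : A →ₗ[R] B} {g : B →ₗ[R] C} (h : SES f g) (V : Type u) [AddCommGroup V]
    [Module R V] (i : ℕ) : EMod R A V i →ₗ[R] EMod R C V (i + 1) :=
  h.shortExact.extClass.precompOfLinear R (ModuleCat.of R V) (add_comm 1 i)

variable {f : A →ₗ[R] B} {g : B →ₗ[R] C}

lemma SES.exact_mid (h : SES f g) (V : Type u) [AddCommGroup V] [Module R V] (i : ℕ) :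
    Function.Exact (extPre g V i) (extPre f V i) := by
  intro x
  constructor
  · intro hx
    exact Abelian.Ext.contravariant_sequence_exact₂ h.shortExact _ x hx
  · rintro ⟨y, rfl⟩
    rw [extPre_extPre, h.comp_eq_zero, extPre_zero]

lemma SES.exact_left (h : SES f g) (V : Type u) [AddCommGroup V] [Module R V] (i : ℕ) :
    Function.Exact (extPre f V i) (h.δ V i) := by
  intro x
  constructor
  · intro hx
    exact Abelian.Ext.contravariant_sequence_exact₁ h.shortExact _ x (add_comm 1 i) hx
  · rintro ⟨y, rfl⟩
    exact h.shortExact.extClass_comp_assoc y (h := add_comm 1 i)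

lemma SES.exact_right (h : SES f g) (V : Type u) [AddCommGroup V] [Module R V] (i : ℕ) :
    Function.Exact (h.δ V i) (extPre g V (i + 1)) := by
  intro x
  constructor
  · intro hx
    exact Abelian.Ext.contravariant_sequence_exact₃ h.shortExact _ x hx (add_comm 1 i)
  · rintro ⟨y, rfl⟩
    exact h.shortExact.comp_extClass_assoc y (add_comm 1 i)

lemma subsingleton_of_exact {P Q S : Type*} [AddCommGroup P] [AddCommGroup Q] [AddCommGroup S]
    [Module R P] [Module R Q] [Module R S] {p : P →ₗ[R] Q} {q : Q →ₗ[R] S}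
    (h : Function.Exact p q) (_ : Subsingleton P) (_ : Subsingleton S) : Subsingleton Q := by
  refine subsingleton_of_forall_eq 0 fun x => ?_
  obtain ⟨y, rfl⟩ := (h x).mp (Subsingleton.elim _ _)
  rw [Subsingleton.elim y 0, map_zero]

lemma SES.subsingleton_left (h : SES f g) {i : ℕ} (hB : Subsingleton (EMod R B V i))
    (hC : Subsingleton (EMod R C V (i + 1))) : Subsingleton (EMod R A V i) :=
  subsingleton_of_exact (h.exact_left V i) hB hC

lemma SES.subsingleton_right (h : SES f g) {i : ℕ} (hA : Subsingleton (EMod R A V i))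
    (hB : Subsingleton (EMod R B V (i + 1))) : Subsingleton (EMod R C V (i + 1)) :=
  subsingleton_of_exact (h.exact_right V i) hA hB

lemma SES.exists_extension (h : SES f g) (hC : Subsingleton (EMod R C V 1)) (φ : A →ₗ[R] V) :
    ∃ ψ : B →ₗ[R] V, ψ ∘ₗ f = φ := by
  obtain ⟨y, hy⟩ := (h.exact_left V 0 ((extZero A V).symm φ)).mp (Subsingleton.elim _ _)
  refine ⟨extZero B V y, ?_⟩
  rw [← extZero_extPre, hy]; simp

lemma SES.subsingleton_ext_one (h : SES f g) (hB : Subsingleton (EMod R B V 1))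
    (hext : ∀ φ : A →ₗ[R] V, ∃ ψ : B →ₗ[R] V, ψ ∘ₗ f = φ) : Subsingleton (EMod R C V 1) := by
  refine subsingleton_of_forall_eq 0 fun x => ?_
  obtain ⟨y, rfl⟩ := (h.exact_right V 0 x).mp (Subsingleton.elim _ _)
  obtain ⟨φ, rfl⟩ := (extZero A V).symm.surjective y
  obtain ⟨ψ, rfl⟩ := hext φ
  exact (h.exact_left V 0 _).mpr ⟨(extZero B V).symm ψ, extPre_extZero_symm f ψ⟩

/-- Dimension shifting. -/
def SES.shift (h : SES f g) {i : ℕ} (hB : Subsingleton (EMod R B V i))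
    (hB' : Subsingleton (EMod R B V (i + 1))) : EMod R A V i ≃ₗ[R] EMod R C V (i + 1) :=
  LinearEquiv.ofBijective (h.δ V i) (by
    constructor
    · refine (injective_iff_map_eq_zero _).mpr fun x hx => ?_
      obtain ⟨y, rfl⟩ := (h.exact_left V i x).mp hx
      rw [Subsingleton.elim y 0, map_zero]
    · intro x
      exact (h.exact_right V i x).mp (Subsingleton.elim _ _))

/-- `Ext¹` as a cokernel of `Hom` groups. -/
lemma SES.exists_ext_one_equiv (h : SES f g) (hB : Subsingleton (EMod R B V 1))
    {D : Type*} [AddCommGroup D] [Module R D] (q : (A →ₗ[R] V) →ₗ[R] D)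
    (hq : Function.Surjective q)
    (hker : ∀ φ : A →ₗ[R] V, q φ = 0 ↔ ∃ ψ : B →ₗ[R] V, ψ ∘ₗ f = φ) :
    Nonempty (EMod R C V 1 ≃ₗ[R] D) := by
  let p : (A →ₗ[R] V) →ₗ[R] EMod R C V 1 := h.δ V 0 ∘ₗ (extZero A V).symm.toLinearMap
  have hp : Function.Surjective p := fun x => by
    obtain ⟨y, rfl⟩ := (h.exact_right V 0 x).mp (Subsingleton.elim _ _)
    exact ⟨extZero A V y, by simp [p]⟩
  have hpk : LinearMap.ker p = LinearMap.ker q := by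
    ext φ
    rw [LinearMap.mem_ker, LinearMap.mem_ker, hker]
    refine (h.exact_left V 0 _).trans ⟨?_, ?_⟩
    · rintro ⟨y, hy⟩
      refine ⟨extZero B V y, ?_⟩
      rw [← extZero_extPre, hy]; simp
    · rintro ⟨ψ, rfl⟩
      exact ⟨(extZero B V).symm ψ, extPre_extZero_symm f ψ⟩
  exact ⟨(p.quotKerEquivOfSurjective hp).symm.trans
    ((Submodule.quotEquivOfEq _ _ hpk).trans (q.quotKerEquivOfSurjective hq))⟩

lemma SES.subsingleton_covariant (h : SES f g) {i : ℕ} (hB : Subsingleton (EMod R V B i))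
    (hA : Subsingleton (EMod R V A (i + 1))) : Subsingleton (EMod R V C i) := by
  refine subsingleton_of_forall_eq 0 fun x => ?_
  obtain ⟨y, rfl⟩ := Abelian.Ext.covariant_sequence_exact₃ (ModuleCat.of R V) h.shortExact x rfl
    (Subsingleton.elim (α := EMod R V A (i + 1)) _ _)
  obtain rfl : y = 0 := Subsingleton.elim (α := EMod R V B i) _ _
  exact Abelian.Ext.zero_comp (C := ModuleCat.{u} R) _ _ _ _ _

lemma SES.subsingleton_covariant_left (h : SES f g) {i : ℕ} (hC : Subsingleton (EMod R V C i))
    (hB : Subsingleton (EMod R V B (i + 1))) : Subsingleton (EMod R V A (i + 1)) := by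
  refine subsingleton_of_forall_eq 0 fun x => ?_
  obtain ⟨y, rfl⟩ := Abelian.Ext.covariant_sequence_exact₁ (ModuleCat.of R V) h.shortExact x
    (Subsingleton.elim (α := EMod R V B (i + 1)) _ _) rfl
  obtain rfl : y = 0 := Subsingleton.elim (α := EMod R V C i) _ _
  exact Abelian.Ext.zero_comp (C := ModuleCat.{u} R) _ _ _ _ _

lemma subsingleton_ext_of_projective [Module.Projective R A] (i : ℕ) :
    Subsingleton (EMod R A V (i + 1)) := by
  have : Projective (ModuleCat.of R A) :=
    (IsProjective.iff_projective A).mp inferInstance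
  exact subsingleton_of_forall_eq 0 fun x => x.eq_zero_of_projective

lemma subsingleton_ext_of_projective' [Module.Projective R A] {i : ℕ} (hi : 0 < i) :
    Subsingleton (EMod R A V i) := by
  obtain ⟨j, rfl⟩ := Nat.exists_eq_succ_of_ne_zero hi.ne'
  exact subsingleton_ext_of_projective j

lemma subsingleton_ext_of_subsingleton [Subsingleton A] (i : ℕ) :
    Subsingleton (EMod R A V i) := by
  refine subsingleton_of_forall_eq 0 fun x => ?_
  rw [← extPre_id i x, Subsingleton.elim LinearMap.id (0 : A →ₗ[R] A), extPre_zero]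

lemma subsingleton_ext_of_subsingleton_right [Subsingleton V] (i : ℕ) :
    Subsingleton (EMod R A V i) := by
  refine subsingleton_of_forall_eq 0 fun x => ?_
  have h : 𝟙 (ModuleCat.of R V) = 0 := by
    apply ModuleCat.hom_ext
    exact Subsingleton.elim _ _
  rw [← Abelian.Ext.comp_mk₀_id x, h, Abelian.Ext.mk₀_zero, Abelian.Ext.comp_zero]

lemma subsingleton_ext_congr (e : A ≃ₗ[R] B) {i : ℕ} (h : Subsingleton (EMod R A V i)) :
    Subsingleton (EMod R B V i) :=
  (extCongr e V i).toEquiv.subsingleton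

lemma subsingleton_ext_congr_right (e : V ≃ₗ[R] V') {i : ℕ} (h : Subsingleton (EMod R A V i)) :
    Subsingleton (EMod R A V' i) := by
  refine subsingleton_of_forall_eq 0 fun x => ?_
  have h1 : (x.comp (Abelian.Ext.mk₀ (ModuleCat.ofHom e.symm.toLinearMap)) (add_zero i) :
    EMod R A V i) = 0 := Subsingleton.elim _ _
  have h2 := congrArg (fun y : EMod R A V i =>
    y.comp (Abelian.Ext.mk₀ (ModuleCat.ofHom e.toLinearMap)) (add_zero i)) h1
  simp only [Abelian.Ext.comp_assoc_of_third_deg_zero, Abelian.Ext.mk₀_comp_mk₀,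
    Abelian.Ext.zero_comp, ← ModuleCat.ofHom_comp] at h2
  rw [← h2, show (e.toLinearMap ∘ₗ e.symm.toLinearMap) = LinearMap.id by ext; simp,
    ModuleCat.ofHom_id, Abelian.Ext.comp_mk₀_id]

lemma subsingleton_ext_pi {i : ℕ} (k : ℕ) (h : Subsingleton (EMod R A V i)) :
    Subsingleton (EMod R (Fin k → A) V i) := by
  refine subsingleton_of_forall_eq 0 fun x => ?_
  have : (LinearMap.id : (Fin k → A) →ₗ[R] (Fin k → A)) =
      ∑ j, LinearMap.single R (fun _ => A) j ∘ₗ LinearMap.proj j := by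
    ext j x l; simp [Finset.sum_apply, Pi.single_apply]
  rw [← extPre_id i x, this, extPre_sum]
  refine Finset.sum_eq_zero fun j _ => ?_
  rw [← extPre_extPre, Subsingleton.elim (extPre (LinearMap.single R (fun _ => A) j) V i x) 0,
    map_zero]

lemma subsingleton_ext_pi_right {i : ℕ} (k : ℕ) (h : Subsingleton (EMod R A V i)) :
    Subsingleton (EMod R A (Fin k → V) i) := by
  refine subsingleton_of_forall_eq 0 fun x => ?_
  have hid : (LinearMap.id : (Fin k → V) →ₗ[R] (Fin k → V)) =
      ∑ j, LinearMap.single R (fun _ => V) j ∘ₗ LinearMap.proj j := by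
    ext j x l; simp [Finset.sum_apply, Pi.single_apply]
  have hid' : 𝟙 (ModuleCat.of R (Fin k → V)) = ∑ j, ModuleCat.ofHom (LinearMap.proj j) ≫
      ModuleCat.ofHom (LinearMap.single R (fun _ => V) j) := by
    apply ModuleCat.hom_ext
    rw [ModuleCat.hom_sum]
    exact hid
  rw [← Abelian.Ext.comp_mk₀_id x, hid', Abelian.Ext.mk₀_sum, Abelian.Ext.comp_sum]
  refine Finset.sum_eq_zero fun j _ => ?_
  rw [← Abelian.Ext.mk₀_comp_mk₀, ← Abelian.Ext.comp_assoc_of_third_deg_zero,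
    Subsingleton.elim (α := EMod R A V i) (x.comp _ _) 0, Abelian.Ext.zero_comp]

end ExtGroups

section Conversions

variable {R : Type u} [CommRing R]

lemma linearYonedaObj_exactAt_iff {α : Type*} [AddRightCancelSemigroup α] [One α]
    (X : ChainComplex (ModuleCat.{u} R) α) (V : ModuleCat.{u} R) (i j k : α)
    (hi : (ComplexShape.up α).prev j = i) (hk : (ComplexShape.up α).next j = k) :
    (X.linearYonedaObj R V).ExactAt j ↔
      ∀ f : X.X j ⟶ V, X.d k j ≫ f = 0 → ∃ g : X.X i ⟶ V, X.d j i ≫ g = f := by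
  rw [HomologicalComplex.exactAt_iff' _ i j k hi hk, ShortComplex.moduleCat_exact_iff]
  rfl

lemma isZero_extMod_iff (M V : ModuleCat.{u} R) (i : ℕ) :
    IsZero (ExtMod R i M V) ↔ Subsingleton (Abelian.Ext M V i) := by
  let P := projectiveResolution M
  rw [(P.isoExt (R := R) i V).isZero_iff, ← HomologicalComplex.exactAt_iff_isZero_homology]
  obtain _ | i := i
  · rw [linearYonedaObj_exactAt_iff _ _ 0 0 1 (by simp) (by simp),
      Abelian.Ext.addEquiv₀.toEquiv.subsingleton_congr]
    obtain ⟨p, w, hp, hex⟩ : ∃ (p : P.complex.X 0 ⟶ M) (w : P.complex.d 1 0 ≫ p = 0), Epi p ∧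
        (ShortComplex.mk _ p w).Exact :=
      ⟨P.π.f 0, P.complex_d_comp_π_f_zero, inferInstanceAs (Epi (P.π.f 0)), P.exact₀⟩
    constructor
    · refine fun h => subsingleton_of_forall_eq 0 fun f => ?_
      obtain ⟨g, hg⟩ := h (p ≫ f) (by rw [← Category.assoc, w, zero_comp])
      rw [P.complex.shape 0 0 (by simp), zero_comp] at hg
      rw [← cancel_epi p, ← hg, comp_zero]
    · intro h f hf
      refine ⟨0, ?_⟩
      have : Epi (ShortComplex.mk _ p w).g := hp
      have h1 := hex.g_desc f hf
      have h2 : hex.desc f hf = 0 := Subsingleton.elim (α := M ⟶ V) _ _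
      rw [comp_zero, ← h1, h2, comp_zero]
  · rw [linearYonedaObj_exactAt_iff _ _ i (i + 1) (i + 2) (by simp) (by simp)]
    constructor
    · refine fun h => subsingleton_of_forall_eq 0 fun x => ?_
      obtain ⟨f, hf, rfl⟩ := P.extMk_surjective x (i + 2) rfl
      rw [P.extMk_eq_zero_iff f _ rfl hf i rfl]
      exact h f hf
    · intro h f hf
      exact (P.extMk_eq_zero_iff f _ rfl hf i rfl).mp (Subsingleton.elim _ _)

lemma le_gradeM_iff (M : ModuleCat.{u} R) (n : ℕ) :
    (n : ℕ∞) ≤ gradeM R M ↔ ∀ i < n, Subsingleton (Abelian.Ext M (ModuleCat.of R R) i) := by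
  unfold gradeM
  rw [le_sInf_iff]
  constructor
  · intro h i hi
    by_contra hc
    have := h i ⟨i, rfl, by rwa [isZero_extMod_iff]⟩
    exact absurd (Nat.cast_le.mp this) (by omega)
  · rintro h _ ⟨i, rfl, hi⟩
    rw [isZero_extMod_iff] at hi
    by_contra hc
    exact hi (h i (by simpa using hc))

lemma not_subsingleton_of_gradeM_eq {M : ModuleCat.{u} R} {n : ℕ} (h : gradeM R M = n) :
    ¬ Subsingleton (Abelian.Ext M (ModuleCat.of R R) n) := by
  intro hs
  have h1 : ((n + 1 : ℕ) : ℕ∞) ≤ gradeM R M := by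
    rw [le_gradeM_iff]
    intro i hi
    rcases Nat.lt_succ_iff_lt_or_eq.mp hi with h' | rfl
    · exact (le_gradeM_iff M n).mp h.ge i h'
    · exact hs
  rw [h] at h1
  exact absurd (Nat.cast_le.mp h1) (by omega)

lemma enat_sInf_eq_coe {p : ℕ → Prop} {n : ℕ}
    (h : sInf {c : ℕ∞ | ∃ k : ℕ, c = k ∧ p k} = (n : ℕ∞)) : p n := by
  have hne : {c : ℕ∞ | ∃ k : ℕ, c = k ∧ p k}.Nonempty := by
    by_contra hc
    rw [Set.not_nonempty_iff_eq_empty] at hc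
    rw [hc, sInf_empty] at h
    exact ENat.natCast_ne_top n h.symm
  obtain ⟨k, hk, hpk⟩ := csInf_mem hne
  rw [h] at hk
  rwa [Nat.cast_inj.mp hk]

lemma gdimLE_of_gdim_eq {M : ModuleCat.{u} R} {n : ℕ} (h : gdim R M = n) : GDimLE R M n :=
  enat_sInf_eq_coe h

/-- A left resolution of length `n`, with terms `Ext`-acyclic for `V`, bounds the degrees
where `Ext(M, V)` can be nonzero. -/
lemma subsingleton_ext_of_resolution (V : ModuleCat.{u} R) (n : ℕ) :
    ∀ (M : ModuleCat.{u} R) (G : ChainComplex (ModuleCat.{u} R) ℕ) (ε : G.X 0 ⟶ M),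
    (∀ i j, 0 < j → Subsingleton (Abelian.Ext (G.X i) V j)) →
    (∀ i, n < i → IsZero (G.X i)) → Epi ε →
    (∃ w : G.d 1 0 ≫ ε = 0, (ShortComplex.mk (G.d 1 0) ε w).Exact) →
    (∀ i, 0 < i → G.ExactAt i) → ∀ j, n < j → Subsingleton (Abelian.Ext M V j) := by
  intro M G ε hG hz hε hw hex j hj
  obtain ⟨w, hw⟩ := hw
  have hcomp : ∀ i, (G.d (i + 1) i).hom ∘ₗ (G.d (i + 2) (i + 1)).hom = 0 := fun i => by
    rw [← ModuleCat.hom_comp, G.d_comp_d]; rfl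
  have hexact : ∀ i, Function.Exact (G.d (i + 2) (i + 1)).hom (G.d (i + 1) i).hom := by
    intro i
    have := hex (i + 1) (by omega)
    rw [HomologicalComplex.exactAt_iff' _ (i + 2) (i + 1) i (by simp) (by simp)] at this
    exact (ShortComplex.ShortExact.moduleCat_exact_iff_function_exact _).mp this
  have hrange : ∀ i, n ≤ i → Subsingleton (LinearMap.range (G.d (i + 1) i).hom) := by
    intro i hi
    have := ModuleCat.isZero_iff_subsingleton.mp (hz (i + 1) (by omega))
    refine subsingleton_of_forall_eq 0 ?_
    rintro ⟨_, x, rfl⟩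
    ext
    rw [Subsingleton.elim x 0]; simp
  have key : ∀ k i, n ≤ i + k → ∀ j, n < i + 1 + j →
      Subsingleton (EMod R (LinearMap.range (G.d (i + 1) i).hom) V j) := by
    intro k
    induction k with
    | zero =>
      intro i hi j _
      have := hrange i hi
      exact subsingleton_ext_of_subsingleton j
    | succ k ih =>
      intro i hi j hj
      by_cases hin : n ≤ i
      · have := hrange i hin
        exact subsingleton_ext_of_subsingleton j
      obtain _ | j := j
      · omega
      have hS : SES (LinearMap.range (G.d (i + 2) (i + 1)).hom).subtype
          (G.d (i + 1) i).hom.rangeRestrict := by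
        refine ⟨Subtype.val_injective, ?_, LinearMap.surjective_rangeRestrict _⟩
        rw [LinearMap.exact_iff, LinearMap.ker_rangeRestrict, Submodule.range_subtype]
        exact (hexact i).linearMap_ker_eq
      exact hS.subsingleton_right (ih (i + 1) (by omega) j (by omega))
        (hG (i + 1) (j + 1) (by omega))
  obtain _ | j := j
  · omega
  have hS : SES (LinearMap.range (G.d 1 0).hom).subtype ε.hom := by
    refine ⟨Subtype.val_injective, ?_, (ModuleCat.epi_iff_surjective _).mp hε⟩
    rw [LinearMap.exact_iff, Submodule.range_subtype]
    exact ((ShortComplex.ShortExact.moduleCat_exact_iff_function_exact _).mp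
      hw).linearMap_ker_eq
  exact hS.subsingleton_right (key n 0 (by omega) j (by omega)) (hG 0 (j + 1) (by omega))

lemma subsingleton_ext_of_gdimLE {M : ModuleCat.{u} R} {n : ℕ} (h : GDimLE R M n) {j : ℕ}
    (hj : n < j) : Subsingleton (Abelian.Ext M (ModuleCat.of R R) j) := by
  obtain ⟨G, ε, hG, hz, hε, hw, hex⟩ := h
  refine subsingleton_ext_of_resolution _ n M G ε (fun i k hk => ?_) hz hε hw hex j hj
  by_cases hi : i ≤ n
  · exact (isZero_extMod_iff _ _ _).mp ((hG i hi).2.2.1 k hk)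
  · have := ModuleCat.isZero_iff_subsingleton.mp (hz i (by omega))
    exact subsingleton_ext_of_subsingleton (R := R) (A := G.X i) (V := R) k

lemma subsingleton_ext_of_pdLE {M : ModuleCat.{u} R} {n : ℕ} (h : PdLE R M n)
    (V : ModuleCat.{u} R) {j : ℕ} (hj : n < j) : Subsingleton (Abelian.Ext M V j) := by
  obtain ⟨G, ε, hG, hz, hε, hw, hex⟩ := h
  refine subsingleton_ext_of_resolution _ n M G ε (fun i k hk => ?_) hz hε hw hex j hj
  obtain ⟨k, rfl⟩ := Nat.exists_eq_succ_of_ne_zero hk.ne'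
  have := hG i
  exact subsingleton_of_forall_eq 0 fun x => x.eq_zero_of_projective

lemma exists_subsingleton_ext_of_finiteInjDim {V : ModuleCat.{u} R} (h : HasFiniteInjDim R V) :
    ∃ d : ℕ, ∀ (M : ModuleCat.{u} R) (j : ℕ), d < j → Subsingleton (Abelian.Ext M V j) := by
  obtain ⟨d, I, ι, hI, hz, hι, ⟨w, hw⟩, hex⟩ := h
  refine ⟨d, fun M j hj => ?_⟩
  have hinj : ∀ i j, 0 < j → Subsingleton (EMod R M (I.X i) j) := fun i j hj => by
    obtain ⟨j, rfl⟩ := Nat.exists_eq_succ_of_ne_zero hj.ne'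
    have := hI i
    exact subsingleton_of_forall_eq 0 fun x => x.eq_zero_of_injective
  have hexact : ∀ i, Function.Exact (I.d i (i + 1)).hom (I.d (i + 1) (i + 2)).hom := by
    intro i
    have := hex (i + 1) (by omega)
    rw [HomologicalComplex.exactAt_iff' _ i (i + 1) (i + 2) (by simp) (by simp)] at this
    exact (ShortComplex.ShortExact.moduleCat_exact_iff_function_exact _).mp this
  have key : ∀ k i, d ≤ i + k → ∀ j, d < i + 1 + j →
      Subsingleton (EMod R M (LinearMap.range (I.d i (i + 1)).hom) j) := by
    have hrange : ∀ i, d ≤ i → Subsingleton (LinearMap.range (I.d i (i + 1)).hom) := by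
      intro i hi
      have := ModuleCat.isZero_iff_subsingleton.mp (hz (i + 1) (by omega))
      infer_instance
    intro k
    induction k with
    | zero =>
      intro i hi j hj
      have := hrange i hi
      exact subsingleton_ext_of_subsingleton_right j
    | succ k ih =>
      intro i hi j hj
      by_cases hin : d ≤ i
      · have := hrange i hin
        exact subsingleton_ext_of_subsingleton_right j
      obtain _ | j := j
      · omega
      have hS : SES (LinearMap.range (I.d i (i + 1)).hom).subtype
          (I.d (i + 1) (i + 2)).hom.rangeRestrict := by
        refine ⟨Subtype.val_injective, ?_, LinearMap.surjective_rangeRestrict _⟩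
        rw [LinearMap.exact_iff, LinearMap.ker_rangeRestrict, Submodule.range_subtype]
        exact (hexact i).linearMap_ker_eq
      exact hS.subsingleton_covariant_left (ih (i + 1) (by omega) j (by omega))
        (hinj (i + 1) (j + 1) (by omega))
  obtain _ | j := j
  · omega
  have hS : SES ι.hom (I.d 0 1).hom.rangeRestrict := by
    refine ⟨(ModuleCat.mono_iff_injective _).mp hι, ?_, LinearMap.surjective_rangeRestrict _⟩
    rw [LinearMap.exact_iff, LinearMap.ker_rangeRestrict]
    exact ((ShortComplex.ShortExact.moduleCat_exact_iff_function_exact _).mp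
      hw).linearMap_ker_eq
  exact hS.subsingleton_covariant_left (key d 0 (by omega) j (by omega))
    (hinj 0 (j + 1) (by omega))

end Conversions

section ChangeOfRings

variable {R S : Type u} [CommRing R] [CommRing S] [Algebra R S]

/-- Restriction of scalars of a short exact sequence. -/
lemma SES.restrictScalars {A B C : Type u} [AddCommGroup A] [Module R A] [Module S A]
    [IsScalarTower R S A] [AddCommGroup B] [Module R B] [Module S B] [IsScalarTower R S B]
    [AddCommGroup C] [Module R C] [Module S C] [IsScalarTower R S C]
    {f : A →ₗ[S] B} {g : B →ₗ[S] C} (h : SES f g) :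
    SES (f.restrictScalars R) (g.restrictScalars R) :=
  ⟨h.inj, h.exact, h.surj⟩

variable (R S) in
/-- The module `Ext^c_R(S, R)`, with its natural structure of `S`-module. -/
def CanMod (c : ℕ) : Type u := EMod R S R c

instance (c : ℕ) : AddCommGroup (CanMod R S c) := inferInstanceAs (AddCommGroup (EMod R S R c))

instance (c : ℕ) : Module R (CanMod R S c) := inferInstanceAs (Module R (EMod R S R c))

instance (c : ℕ) : SMul S (CanMod R S c) :=
  ⟨fun s ξ => extPre (LinearMap.mulLeft R s) R c (show EMod R S R c from ξ)⟩

lemma extPre_mulLeft_add (c : ℕ) (s t : S) (ξ : EMod R S R c) :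
    extPre (LinearMap.mulLeft R (s + t)) R c ξ =
      extPre (LinearMap.mulLeft R s) R c ξ + extPre (LinearMap.mulLeft R t) R c ξ := by
  rw [← extPre_add]
  congr 2
  ext x; simp [add_mul]

lemma extPre_mulLeft_mul (c : ℕ) (s t : S) (ξ : EMod R S R c) :
    extPre (LinearMap.mulLeft R (s * t)) R c ξ =
      extPre (LinearMap.mulLeft R s) R c (extPre (LinearMap.mulLeft R t) R c ξ) := by
  rw [extPre_extPre, ← LinearMap.mulLeft_mul, mul_comm s t]

lemma extPre_mulLeft_one (c : ℕ) (ξ : EMod R S R c) :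
    extPre (LinearMap.mulLeft R (1 : S)) R c ξ = ξ := by
  rw [LinearMap.mulLeft_one, extPre_id]

lemma extPre_mulLeft_smul (c : ℕ) (r : R) (s : S) (ξ : EMod R S R c) :
    extPre (LinearMap.mulLeft R (r • s)) R c ξ = r • extPre (LinearMap.mulLeft R s) R c ξ := by
  rw [← extPre_smul]
  congr 2
  ext x; simp

instance (c : ℕ) : Module S (CanMod R S c) :=
  Module.ofMinimalAxioms
    (fun s x y => map_add (extPre (LinearMap.mulLeft R s) R c) x y)
    (fun s t x => extPre_mulLeft_add c s t x)
    (fun s t x => extPre_mulLeft_mul c s t x)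
    (fun x => extPre_mulLeft_one c x)

instance (c : ℕ) : IsScalarTower R S (CanMod R S c) where
  smul_assoc r s x := extPre_mulLeft_smul c r s x

variable {A B C L L' : Type u} [AddCommGroup A] [Module R A] [Module S A]
    [IsScalarTower R S A] [AddCommGroup B] [Module R B] [Module S B] [IsScalarTower R S B]
    [AddCommGroup C] [Module R C] [Module S C] [IsScalarTower R S C]
    [AddCommGroup L] [Module R L] [Module S L] [IsScalarTower R S L]
    [AddCommGroup L'] [Module R L'] [Module S L'] [IsScalarTower R S L']

variable (R) in
/-- The `R`-linear map `S → L` determined by an element of the `S`-module `L`. -/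
def spanMap (x : L) : S →ₗ[R] L := (LinearMap.toSpanSingleton S L x).restrictScalars R

lemma spanMap_add (x y : L) : spanMap R (S := S) (x + y) = spanMap R x + spanMap R y := by
  ext s; simp [spanMap]

lemma spanMap_smul (s : S) (x : L) :
    spanMap R (S := S) (s • x) = spanMap R x ∘ₗ LinearMap.mulLeft R s := by
  ext t; simp [spanMap, mul_smul, smul_comm t s x]

/-- The evaluation map `Ext^c_R(L, R) → Hom_S(L, Ext^c_R(S, R))`. -/
def extEv (S : Type u) [CommRing S] [Algebra R S] (L : Type u) [AddCommGroup L] [Module R L]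
    [Module S L] [IsScalarTower R S L] (c : ℕ) :
    EMod R L R c →ₗ[R] (L →ₗ[S] CanMod R S c) where
  toFun ξ :=
    { toFun := fun x => extPre (spanMap R (S := S) x) R c ξ
      map_add' := fun x y => by rw [spanMap_add]; exact extPre_add _ _ c ξ
      map_smul' := fun s x => by
        rw [spanMap_smul]
        exact (extPre_extPre _ _ c ξ).symm }
  map_add' ξ η := by
    ext x
    exact map_add (extPre (spanMap R (S := S) x) R c) ξ η
  map_smul' r ξ := by
    ext x
    exact map_smul (extPre (spanMap R (S := S) x) R c) r ξ

lemma extEv_apply (c : ℕ) (ξ : EMod R L R c) (x : L) :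
    extEv S L c ξ x = extPre (spanMap R (S := S) x) R c ξ := rfl

lemma extEv_extPre (f : L →ₗ[S] L') (c : ℕ) (ξ : EMod R L' R c) :
    extEv S L c (extPre (f.restrictScalars R) R c ξ) = extEv S L' c ξ ∘ₗ f := by
  ext x
  rw [LinearMap.comp_apply, extEv_apply, extEv_apply, extPre_extPre]
  have : f.restrictScalars R ∘ₗ spanMap R (S := S) x = spanMap R (f x) := by
    ext s; simp [spanMap]
  rw [this]

lemma extEv_pi_bijective (k c : ℕ) : Function.Bijective (extEv (R := R) S (Fin k → S) c) := by
  have hs : ∀ j : Fin k, spanMap R (S := S) (Pi.single j 1 : Fin k → S) =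
      LinearMap.single R (fun _ => S) j := by
    intro j; ext s l; simp [spanMap, Pi.single_apply]
  constructor
  · refine (injective_iff_map_eq_zero _).mpr fun ξ hξ => ?_
    have : (LinearMap.id : (Fin k → S) →ₗ[R] (Fin k → S)) =
        ∑ j, LinearMap.single R (fun _ => S) j ∘ₗ LinearMap.proj j := by
      ext j x l; simp [Finset.sum_apply, Pi.single_apply]
    rw [← extPre_id c ξ, this, extPre_sum]
    refine Finset.sum_eq_zero fun j _ => ?_
    have h0 : extPre (LinearMap.single R (fun _ => S) j) R c ξ = 0 := by
      have := LinearMap.congr_fun hξ (Pi.single j 1)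
      rw [extEv_apply, hs] at this
      exact this
    rw [← extPre_extPre, h0, map_zero]
  · intro φ
    let η : Fin k → EMod R S R c := fun j => φ (Pi.single j 1)
    refine ⟨∑ j, extPre (LinearMap.proj j) R c (η j), ?_⟩
    refine (Pi.basisFun S (Fin k)).ext fun l => ?_
    rw [Pi.basisFun_apply, extEv_apply, hs, map_sum]
    rw [Finset.sum_eq_single l]
    · rw [extPre_extPre, LinearMap.proj_comp_single_same, extPre_id]
    · intro j _ hj
      rw [extPre_extPre, LinearMap.proj_comp_single_ne R (fun _ => S) j l hj, extPre_zero]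
    · simp

lemma extPre_injective {V : Type u} [AddCommGroup V] [Module R V] {f : A →ₗ[R] B}
    {g : B →ₗ[R] C} (h : SES f g) (c : ℕ)
    (hA : ∀ i < c, Subsingleton (EMod R A V i)) : Function.Injective (extPre g V c) := by
  refine (injective_iff_map_eq_zero _).mpr fun ξ hξ => ?_
  obtain _ | c := c
  · have h1 := extZero_extPre g ξ
    rw [hξ, map_zero] at h1
    have : extZero C V ξ = 0 := by
      ext x
      obtain ⟨y, rfl⟩ := h.surj x
      exact (LinearMap.congr_fun h1 y).symm
    simpa using this
  · obtain ⟨y, rfl⟩ := (h.exact_right V c ξ).mp hξ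
    have := hA c (by omega)
    rw [Subsingleton.elim y 0, map_zero]

lemma subsingleton_ext_zero_of_surj {V : Type u} [AddCommGroup V] [Module R V]
    {g : B →ₗ[R] C} (hg : Function.Surjective g) (hB : Subsingleton (EMod R B V 0)) :
    Subsingleton (EMod R C V 0) :=
  (extPre_injective (SES.ker g hg) 0 (by simp)).subsingleton

variable (S) in
/-- A finitely generated module has a finite free cover. -/
lemma exists_cover (L : Type u) [AddCommGroup L] [Module S L] [Module.Finite S L] :
    ∃ (k : ℕ) (g : (Fin k → S) →ₗ[S] L), SES (LinearMap.ker g).subtype g := by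
  obtain ⟨k, g, hg⟩ := Module.Finite.exists_fin' S L
  exact ⟨k, g, SES.ker g hg⟩

section

variable [IsNoetherianRing S] {c : ℕ} {V : Type u} [AddCommGroup V] [Module R V]

lemma subsingleton_ext_of_lt (hS : ∀ i < c, Subsingleton (EMod R S V i)) (i : ℕ) (hi : i < c) :
    ∀ (L : Type u) [AddCommGroup L] [Module R L] [Module S L] [IsScalarTower R S L]
      [Module.Finite S L], Subsingleton (EMod R L V i) := by
  induction i with
  | zero =>
    intro L _ _ _ _ _
    obtain ⟨k, g, hg⟩ := exists_cover S L
    exact subsingleton_ext_zero_of_surj (g := g.restrictScalars R) hg.surj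
      (subsingleton_ext_pi k (hS 0 hi))
  | succ i ih =>
    intro L _ _ _ _ _
    obtain ⟨k, g, hg⟩ := exists_cover S L
    exact (hg.restrictScalars (R := R)).subsingleton_right (ih (by omega) _)
      (subsingleton_ext_pi k (hS (i + 1) hi))

lemma extEv_injective (hS : ∀ i < c, Subsingleton (EMod R S R i)) [Module.Finite S L] :
    Function.Injective (extEv (R := R) S L c) := by
  obtain ⟨k, g, hg⟩ := exists_cover S L
  have h1 := extPre_injective (hg.restrictScalars (R := R)) c
    (fun i hi => subsingleton_ext_of_lt (V := R) hS i hi _)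
  have h2 : Function.Injective (extEv S (Fin k → S) c ∘
      extPre (g.restrictScalars R) R c) := (extEv_pi_bijective k c).1.comp h1
  intro ξ η h
  apply h2
  simp only [Function.comp_apply, extEv_extPre, h]

lemma extEv_bijective (hS : ∀ i < c, Subsingleton (EMod R S R i)) [Module.Finite S L] :
    Function.Bijective (extEv (R := R) S L c) := by
  refine ⟨extEv_injective hS, fun φ => ?_⟩
  obtain ⟨k, g, hg⟩ := exists_cover S L
  obtain ⟨ξ, hξ⟩ := (extEv_pi_bijective k c).2 (φ ∘ₗ g)
  have h0 : extPre ((LinearMap.ker g).subtype.restrictScalars R) R c ξ = 0 := by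
    apply extEv_injective (S := S) hS
    rw [extEv_extPre, hξ, map_zero, LinearMap.comp_assoc, hg.comp_eq_zero, LinearMap.comp_zero]
  obtain ⟨η, rfl⟩ := ((hg.restrictScalars (R := R)).exact_mid R c ξ).mp h0
  refine ⟨η, ?_⟩
  rw [extEv_extPre] at hξ
  ext x
  obtain ⟨y, rfl⟩ := hg.surj x
  exact LinearMap.congr_fun hξ y

/-- Maps into `Ext^c_R(S, R)` extend along an injection with good cokernel. -/
lemma exists_extension_canMod (hS : ∀ i < c, Subsingleton (EMod R S R i)) {f : A →ₗ[S] B}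
    {g : B →ₗ[S] C} (h : SES f g) [Module.Finite S A]
    (hC : Subsingleton (EMod R C R (c + 1))) (φ : A →ₗ[S] CanMod R S c) :
    ∃ ψ : B →ₗ[S] CanMod R S c, ψ ∘ₗ f = φ := by
  obtain ⟨ξ, rfl⟩ := (extEv_bijective hS).2 φ
  obtain ⟨η, rfl⟩ := ((h.restrictScalars (R := R)).exact_left R c ξ).mp (Subsingleton.elim _ _)
  exact ⟨extEv S B c η, (extEv_extPre f c η).symm⟩

lemma subsingleton_ext_canMod (hS : ∀ i, i ≠ c → Subsingleton (EMod R S R i)) (i : ℕ) :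
    ∀ (L : Type u) [AddCommGroup L] [Module R L] [Module S L] [IsScalarTower R S L]
      [Module.Finite S L], (∀ j, c < j → Subsingleton (EMod R L R j)) →
      Subsingleton (EMod S L (CanMod R S c) (i + 1)) := by
  induction i with
  | zero =>
    intro L _ _ _ _ _ hL
    obtain ⟨k, g, hg⟩ := exists_cover S L
    exact hg.subsingleton_ext_one (subsingleton_ext_of_projective 0)
      (exists_extension_canMod (fun i hi => hS i hi.ne) hg (hL _ (by omega)))
  | succ i ih =>
    intro L _ _ _ _ _ hL
    obtain ⟨k, g, hg⟩ := exists_cover S L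
    refine hg.subsingleton_right (ih _ fun j hj => ?_) (subsingleton_ext_of_projective (i + 1))
    exact (hg.restrictScalars (R := R)).subsingleton_left
      (subsingleton_ext_pi k (hS j hj.ne')) (hL _ (by omega))

end

end ChangeOfRings

section Biduality

variable {R S : Type u} [CommRing R] [CommRing S] [Algebra R S]

variable {A B C D K F L V W : Type u} [AddCommGroup A] [Module R A] [AddCommGroup B] [Module R B]
  [AddCommGroup C] [Module R C] [AddCommGroup D] [Module R D] [AddCommGroup V] [Module R V]
  [AddCommGroup K] [Module R K] [AddCommGroup F] [Module R F] [AddCommGroup L] [Module R L]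
  [AddCommGroup W] [Module R W]

lemma SES.exists_desc {f : A →ₗ[R] B} {g : B →ₗ[R] C} (h : SES f g) (φ : B →ₗ[R] V)
    (hφ : φ ∘ₗ f = 0) : ∃ ψ : C →ₗ[R] V, ψ ∘ₗ g = φ := by
  have hk : LinearMap.ker g ≤ LinearMap.ker φ := by
    rw [← h.range_eq]
    exact LinearMap.range_le_ker_iff.mpr hφ
  refine ⟨(LinearMap.ker g).liftQ φ hk ∘ₗ (g.quotKerEquivOfSurjective h.surj).symm.toLinearMap, ?_⟩
  ext x
  have : (g.quotKerEquivOfSurjective h.surj).symm (g x) = (LinearMap.ker g).mkQ x := by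
    rw [LinearEquiv.symm_apply_eq]; rfl
  simp [this]

lemma SES.projective_of_retraction [Module.Projective R F] {f : K →ₗ[R] F}
    {g : F →ₗ[R] L} (h : SES f g) (r : F →ₗ[R] K) (hr : r ∘ₗ f = LinearMap.id) :
    Module.Projective R L := by
  obtain ⟨s, hs⟩ := h.exists_desc (LinearMap.id - f ∘ₗ r) (by
    rw [LinearMap.sub_comp, LinearMap.comp_assoc, hr, LinearMap.id_comp, LinearMap.comp_id,
      sub_self])
  refine Module.Projective.of_split s g ?_
  rw [← LinearMap.cancel_right h.surj, LinearMap.comp_assoc, hs, LinearMap.comp_sub,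
    ← LinearMap.comp_assoc, h.comp_eq_zero, LinearMap.zero_comp, sub_zero, LinearMap.comp_id,
    LinearMap.id_comp]

lemma projective_of_ext_one [Module.Finite R L]
    (hL : ∀ (V : Type u) [AddCommGroup V] [Module R V], Subsingleton (EMod R L V 1)) :
    Module.Projective R L := by
  obtain ⟨k, g, h⟩ := exists_cover R L
  obtain ⟨r, hr⟩ := h.exists_extension (hL _) LinearMap.id
  exact h.projective_of_retraction r hr

/-- `u` identifies `D` with the dual of `L` when `0 < k`, and `W` with the `k`-th cohomology of a
resolution of `L`; when `k = 0`, the module `W` is the cokernel of `u`. -/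
structure DualRel (k : ℕ) (u : D →ₗ[R] Module.Dual R L) (W : Type u) [AddCommGroup W]
    [Module R W] : Prop where
  inj : Function.Injective u
  zero : k = 0 → ∃ w : Module.Dual R L →ₗ[R] W, SES u w
  surj : 0 < k → Function.Surjective u
  ext : 0 < k → Nonempty (EMod R L R k ≃ₗ[R] W)

lemma DualRel.of_ses {f : K →ₗ[R] F} {g : F →ₗ[R] L} (h : SES f g) [Module.Projective R F] {k : ℕ}
    (e : EMod R L R (k + 1) ≃ₗ[R] W) (hL : 0 < k → Subsingleton (EMod R L R 1))
    (u : D →ₗ[R] Module.Dual R K) (hu : Function.Injective u)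
    (hr : LinearMap.range u = LinearMap.range f.dualMap) : DualRel k u W where
  inj := hu
  zero := by
    rintro rfl
    have hF : Subsingleton (EMod R F R 1) := subsingleton_ext_of_projective 0
    refine ⟨e.toLinearMap ∘ₗ h.δ R 0 ∘ₗ (extZero K R).symm.toLinearMap, hu, ?_, ?_⟩
    · rw [LinearMap.exact_iff, hr]
      ext φ
      simp only [LinearMap.mem_ker, LinearMap.comp_apply, LinearEquiv.coe_coe,
        LinearEquiv.map_eq_zero_iff, LinearMap.mem_range]
      refine (h.exact_left R 0 _).trans ⟨?_, ?_⟩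
      · rintro ⟨y, hy⟩
        refine ⟨extZero F R y, ?_⟩
        rw [LinearMap.dualMap_apply', ← extZero_extPre, hy]; simp
      · rintro ⟨ψ, rfl⟩
        exact ⟨(extZero F R).symm ψ, extPre_extZero_symm f ψ⟩
    · have hδ : Function.Surjective (h.δ R 0) :=
        fun x => (h.exact_right R 0 x).mp (Subsingleton.elim _ _)
      exact e.surjective.comp (hδ.comp (extZero K R).symm.surjective)
  surj hk φ := by
    obtain ⟨ψ, hψ⟩ := h.exists_extension (hL hk) φ
    have : φ ∈ LinearMap.range u := hr ▸ ⟨ψ, hψ⟩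
    exact this
  ext hk := ⟨(h.shift (subsingleton_ext_of_projective' hk)
    (subsingleton_ext_of_projective' k.succ_pos)).trans e⟩

variable {f : K →ₗ[R] F} {g : F →ₗ[R] L}

/-- The inclusion of `D` in the dual of a module covering `L`. -/
def dualIncl (u : D →ₗ[R] Module.Dual R L) (g : F →ₗ[R] L) : D →ₗ[R] Module.Dual R F :=
  g.dualMap ∘ₗ u

lemma SES.dualIncl_injective (h : SES f g) {u : D →ₗ[R] Module.Dual R L}
    (hu : Function.Injective u) : Function.Injective (dualIncl u g) :=
  (LinearMap.dualMap_injective_of_surjective h.surj).comp hu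

lemma SES.dualIncl_range_le (h : SES f g) (u : D →ₗ[R] Module.Dual R L) :
    LinearMap.range (dualIncl u g) ≤ LinearMap.ker f.dualMap := by
  rintro _ ⟨d, rfl⟩
  ext x
  simp [dualIncl, h.apply_apply]

lemma SES.dualRel_step (h : SES f g) [Module.Projective R F] {k : ℕ}
    {u : D →ₗ[R] Module.Dual R L} (hu : DualRel (k + 1) u W)
    (hL : 0 < k → Subsingleton (EMod R L R 1)) :
    DualRel k ((LinearMap.range (dualIncl u g)).liftQ f.dualMap (h.dualIncl_range_le u)) W := by
  refine DualRel.of_ses h (hu.ext k.succ_pos).some hL _ ?_ (Submodule.range_liftQ _ _ _)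
  rw [← LinearMap.ker_eq_bot, Submodule.ker_liftQ_eq_bot]
  intro φ hφ
  obtain ⟨ψ, rfl⟩ := h.exists_desc φ hφ
  obtain ⟨d, rfl⟩ := hu.surj k.succ_pos ψ
  exact ⟨d, rfl⟩

lemma SES.ses_dualIncl (h : SES f g) {u : D →ₗ[R] Module.Dual R L} (hu : Function.Injective u) :
    SES (dualIncl u g) (LinearMap.range (dualIncl u g)).mkQ :=
  ⟨h.dualIncl_injective hu, LinearMap.exact_map_mkQ_range _, Submodule.mkQ_surjective _⟩

variable (R S) in
/-- `Ext` of `D` into `R` vanishes above degree `i`, and is `S` in degree `i`. -/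
def TopExt (D : Type u) [AddCommGroup D] [Module R D] (i : ℕ) : Prop :=
  (∀ j, i < j → Subsingleton (EMod R D R j)) ∧ Nonempty (EMod R D R i ≃ₗ[R] S)

lemma TopExt.shift {f : A →ₗ[R] B} {g : B →ₗ[R] C} (h : SES f g) [Module.Projective R B] {i : ℕ}
    (hi : 0 < i) (hA : TopExt R S A i) : TopExt R S C (i + 1) := by
  constructor
  · intro j hj
    obtain ⟨j, rfl⟩ := Nat.exists_eq_succ_of_ne_zero (by omega : j ≠ 0)
    exact h.subsingleton_right (hA.1 j (by omega)) (subsingleton_ext_of_projective j)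
  · obtain ⟨e⟩ := hA.2
    exact ⟨(h.shift (subsingleton_ext_of_projective' hi)
      (subsingleton_ext_of_projective i)).symm.trans e⟩

lemma topExt_of_dualRel [IsNoetherianRing R] (k : ℕ) : ∀ (L D : Type u) [AddCommGroup L]
    [Module R L] [AddCommGroup D] [Module R D] [Module.Finite R L]
    (_ : ∀ (V : Type u) [AddCommGroup V] [Module R V] (j : ℕ), k < j → Subsingleton (EMod R L V j))
    (_ : ∀ j, 0 < j → j < k → Subsingleton (EMod R L R j)) (u : D →ₗ[R] Module.Dual R L)
    (_ : DualRel k u W) (i : ℕ) (_ : 0 < i) (_ : TopExt R S D i), TopExt R S W (i + k + 1) := by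
  induction k with
  | zero =>
    intro L D _ _ _ _ _ hL _ u hu i hi hD
    have : Module.Projective R L := projective_of_ext_one fun V => hL V 1 one_pos
    obtain ⟨w, hw⟩ := hu.zero rfl
    exact hD.shift hw hi
  | succ k ih =>
    intro L D _ _ _ _ _ hL hLR u hu i hi hD
    obtain ⟨r, g, h⟩ := exists_cover R L
    have := ih (LinearMap.ker g) _ (fun V _ _ j hj => h.subsingleton_left
      (subsingleton_ext_of_projective' (by omega)) (hL V (j + 1) (by omega)))
      (fun j hj hjk => h.subsingleton_left (subsingleton_ext_of_projective' (by omega))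
        (hLR (j + 1) (by omega) (by omega))) _
      (h.dualRel_step hu fun hk => hLR 1 one_pos (by omega)) (i + 1) i.succ_pos
      (hD.shift (h.ses_dualIncl hu.inj) hi)
    rwa [show i + 1 + k + 1 = i + (k + 1) + 1 by omega] at this

lemma topExt_one_of_ses {Q : Type u} [AddCommGroup Q] [Module R Q] [Module.Projective R Q]
    [Module.Finite R Q] [Module.Projective R D]
    {v : D →ₗ[R] Module.Dual R Q} {w : Module.Dual R Q →ₗ[R] B} (h : SES v w)
    (q : Module.Dual R D →ₗ[R] S) (hq : Function.Surjective q)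
    (hker : ∀ φ, q φ = 0 ↔ ∃ x : Q, ∀ d, φ d = v d x) : TopExt R S B 1 := by
  constructor
  · intro j hj
    obtain ⟨j, rfl⟩ := Nat.exists_eq_succ_of_ne_zero (by omega : j ≠ 0)
    exact h.subsingleton_right (subsingleton_ext_of_projective' (by omega))
      (subsingleton_ext_of_projective j)
  · refine h.exists_ext_one_equiv (subsingleton_ext_of_projective 0) q hq fun φ => ?_
    rw [hker]
    constructor
    · rintro ⟨x, hx⟩
      exact ⟨Module.evalEquiv R Q x, by ext d; simp [hx]⟩
    · rintro ⟨ψ, rfl⟩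
      obtain ⟨x, rfl⟩ := (Module.evalEquiv R Q).surjective ψ
      exact ⟨x, fun d => by simp⟩

lemma topExt_of_projective [IsNoetherianRing R] (k : ℕ) [Module.Finite R L]
    [Module.Projective R D]
    (hL : ∀ (V : Type u) [AddCommGroup V] [Module R V] (j : ℕ), k < j → Subsingleton (EMod R L V j))
    (hLR : ∀ j, 0 < j → j < k → Subsingleton (EMod R L R j)) (u : D →ₗ[R] Module.Dual R L)
    (hu : DualRel k u W) (q : Module.Dual R D →ₗ[R] S) (hq : Function.Surjective q)
    (hker : ∀ φ, q φ = 0 ↔ ∃ x : L, ∀ d, φ d = u d x) : TopExt R S W (k + 1) := by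
  cases k with
  | zero =>
    have : Module.Projective R L := projective_of_ext_one fun V => hL V 1 one_pos
    obtain ⟨w, hw⟩ := hu.zero rfl
    exact topExt_one_of_ses hw q hq hker
  | succ k =>
    obtain ⟨r, g, h⟩ := exists_cover R L
    have hB := topExt_one_of_ses (h.ses_dualIncl hu.inj) q hq fun φ => by
      rw [hker]
      constructor
      · rintro ⟨x, hx⟩
        obtain ⟨y, rfl⟩ := h.surj x
        exact ⟨y, hx⟩
      · rintro ⟨y, hy⟩
        exact ⟨g y, hy⟩
    have := topExt_of_dualRel k (LinearMap.ker g) _ (fun V _ _ j hj => h.subsingleton_left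
      (subsingleton_ext_of_projective' (by omega)) (hL V (j + 1) (by omega)))
      (fun j hj hjk => h.subsingleton_left (subsingleton_ext_of_projective' (by omega))
        (hLR (j + 1) (by omega) (by omega))) _
      (h.dualRel_step hu fun hk => hLR 1 one_pos (by omega)) 1 one_pos hB
    rwa [show 1 + k + 1 = k + 1 + 1 by omega] at this

theorem topExt_canMod [IsNoetherianRing R] [Module.Finite R S] {c : ℕ}
    (hpd : ∀ (V : Type u) [AddCommGroup V] [Module R V] (j : ℕ), c < j →
      Subsingleton (EMod R S V j))
    (hS : ∀ i < c, Subsingleton (EMod R S R i)) : TopExt R S (CanMod R S c) c := by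
  cases c with
  | zero =>
    have : Module.Projective R S := projective_of_ext_one fun V => hpd V 1 one_pos
    let e : CanMod R S 0 ≃ₗ[R] Module.Dual R S := extZero S R
    constructor
    · intro j hj
      exact subsingleton_ext_congr e.symm (subsingleton_ext_of_projective' hj)
    · exact ⟨(extCongr e.symm R 0).trans ((extZero _ R).trans (Module.evalEquiv R S).symm)⟩
  | succ k =>
    obtain ⟨r, g, h⟩ := exists_cover R S
    have h0 : Subsingleton (S →ₗ[R] R) := subsingleton_ext_zero_iff.mp (hS 0 k.succ_pos)
    have hinj : Function.Injective (LinearMap.ker g).subtype.dualMap := by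
      refine (injective_iff_map_eq_zero _).mpr fun φ hφ => ?_
      obtain ⟨ψ, rfl⟩ := h.exists_desc φ hφ
      rw [Subsingleton.elim ψ 0, LinearMap.zero_comp]
    refine topExt_of_projective k (L := LinearMap.ker g) (fun V _ _ j hj => h.subsingleton_left
      (subsingleton_ext_of_projective' (by omega)) (hpd V (j + 1) (by omega)))
      (fun j hj hjk => h.subsingleton_left (subsingleton_ext_of_projective' (by omega))
        (hS (j + 1) (by omega))) _
      (DualRel.of_ses h (LinearEquiv.refl R (EMod R S R (k + 1))) (fun hk => hS 1 (by omega))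
        _ hinj rfl) (g ∘ₗ (Module.evalEquiv R (Fin r → R)).symm.toLinearMap)
      (h.surj.comp (Module.evalEquiv R (Fin r → R)).symm.surjective) fun φ => ?_
    obtain ⟨y, rfl⟩ := (Module.evalEquiv R (Fin r → R)).surjective φ
    simp only [LinearMap.comp_apply, LinearEquiv.coe_coe, LinearEquiv.symm_apply_apply]
    constructor
    · intro hy
      exact ⟨⟨y, hy⟩, fun d => rfl⟩
    · rintro ⟨x, hx⟩
      have : y = x := (Module.evalEquiv R (Fin r → R)).injective (by
        ext d; exact hx _)
      rw [this]; exact x.2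

end Biduality

section Semidualizing

open TensorProduct in
lemma exists_retraction_of_extension {A : Type u} [CommRing A] [IsLocalRing A]
    {K F W : Type u} [AddCommGroup K] [Module A K] [Module.Finite A K] [Module.Free A K]
    [AddCommGroup F] [Module A F] [Module.Finite A F] [Module.Free A F]
    [AddCommGroup W] [Module A W] [Module.Finite A W] [Nontrivial W] (f : K →ₗ[A] F)
    (hf : ∀ φ : K →ₗ[A] W, ∃ ψ : F →ₗ[A] W, ψ ∘ₗ f = φ) :
    ∃ r : F →ₗ[A] K, r ∘ₗ f = LinearMap.id := by
  rw [IsLocalRing.split_injective_iff_lTensor_residueField_injective]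
  refine (injective_iff_map_eq_zero _).mpr fun x hx => ?_
  obtain ⟨y, rfl⟩ := TensorProduct.mk_surjective A K (IsLocalRing.ResidueField A)
    Ideal.Quotient.mk_surjective x
  have key : ∀ φ : K →ₗ[A] W, (1 : IsLocalRing.ResidueField A) ⊗ₜ[A] φ y = 0 := by
    intro φ
    obtain ⟨ψ, rfl⟩ := hf φ
    simpa using congrArg (ψ.lTensor (IsLocalRing.ResidueField A)) hx
  let b := Module.Free.chooseBasis A K
  have hW : ∃ w : W, (1 : IsLocalRing.ResidueField A) ⊗ₜ[A] w ≠ 0 := by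
    by_contra! h
    have : Subsingleton (IsLocalRing.ResidueField A ⊗[A] W) := by
      refine subsingleton_of_forall_eq 0 fun z => ?_
      obtain ⟨w, rfl⟩ := TensorProduct.mk_surjective A W (IsLocalRing.ResidueField A)
        Ideal.Quotient.mk_surjective z
      exact h w
    rw [IsLocalRing.subsingleton_tensorProduct] at this
    exact not_subsingleton W this
  obtain ⟨w, hw⟩ := hW
  have hy : ∀ i, b.repr y i ∈ IsLocalRing.maximalIdeal A := by
    intro i
    by_contra hi
    rw [IsLocalRing.mem_maximalIdeal, mem_nonunits_iff, not_not] at hi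
    have := key ((LinearMap.toSpanSingleton A W w) ∘ₗ b.coord i)
    simp only [LinearMap.comp_apply, Module.Basis.coord_apply,
      LinearMap.toSpanSingleton_apply, TensorProduct.tmul_smul] at this
    exact hw ((hi.smul_eq_zero).mp this)
  rw [TensorProduct.mk_apply, ← b.sum_repr y, TensorProduct.tmul_sum]
  refine Finset.sum_eq_zero fun i _ => ?_
  rw [← TensorProduct.smul_tmul, Algebra.smul_def, mul_one,
    show algebraMap A (IsLocalRing.ResidueField A) (b.repr y i) = 0 from
      Ideal.Quotient.eq_zero_iff_mem.mpr (hy i), TensorProduct.zero_tmul]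

variable {A : Type u} [CommRing A]

variable {K F G : Type u} [AddCommGroup K] [Module A K] [AddCommGroup F]
    [Module A F] [AddCommGroup G] [Module A G] (W : Type u) [AddCommGroup W] [Module A W]

/-- Precomposition. -/
abbrev homPre (f : K →ₗ[A] F) : (F →ₗ[A] W) →ₗ[A] (K →ₗ[A] W) := LinearMap.lcomp A W f

lemma SES.homPre {f : K →ₗ[A] F} {g : F →ₗ[A] G} (h : SES f g)
    (hG : Subsingleton (EMod A G W 1)) : SES (homPre W g) (homPre W f) where
  inj φ ψ hφψ := (LinearMap.cancel_right h.surj).mp hφψ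
  exact φ := by
    constructor
    · intro hφ
      exact h.exists_desc φ hφ
    · rintro ⟨ψ, rfl⟩
      ext x
      simp [h.apply_apply]
  surj φ := h.exists_extension hG φ

/-- The evaluation map into the `W`-bidual. -/
abbrev evalW (G : Type u) [AddCommGroup G] [Module A G] : G →ₗ[A] ((G →ₗ[A] W) →ₗ[A] W) :=
  LinearMap.applyₗ

variable (A G) in
/-- Modules that are totally reflexive with respect to `W`. -/
structure WRefl : Prop where
  fin : Module.Finite A G
  ext : ∀ i, 0 < i → Subsingleton (EMod A G W i)
  extDual : ∀ i, 0 < i → Subsingleton (EMod A (G →ₗ[A] W) W i)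
  bij : Function.Bijective (evalW (A := A) W G)

variable (A) in
/-- `W` is semidualizing. -/
structure Semidual : Prop where
  fin : Module.Finite A W
  ext : ∀ i, 0 < i → Subsingleton (EMod A W W i)
  bij : Function.Bijective fun a : A => a • (LinearMap.id : W →ₗ[A] W)

variable {W}

lemma Semidual.ext_piDual (hW : Semidual A W) (q : ℕ) {i : ℕ} (hi : 0 < i) :
    Subsingleton (EMod A ((Fin q → A) →ₗ[A] W) W i) :=
  subsingleton_ext_congr (LinearEquiv.piRing A W (Fin q) A).symm
    (subsingleton_ext_pi q (hW.ext i hi))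

lemma Semidual.evalW_pi_bijective (hW : Semidual A W) (q : ℕ) :
    Function.Bijective (evalW (A := A) W (Fin q → A)) := by
  constructor
  · refine (injective_iff_map_eq_zero _).mpr fun x hx => ?_
    ext j
    refine hW.bij.1 ?_
    ext w
    have := LinearMap.congr_fun hx ((LinearMap.toSpanSingleton A W w) ∘ₗ LinearMap.proj j)
    simpa using this
  · intro φ
    have hφ : ∀ j, ∃ a : A, ∀ w : W,
        φ ((LinearMap.toSpanSingleton A W w) ∘ₗ LinearMap.proj j) = a • w := by
      intro j
      obtain ⟨a, ha⟩ := hW.bij.2 (φ ∘ₗ homPre W (LinearMap.proj j : (Fin q → A) →ₗ[A] A) ∘ₗ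
        (LinearMap.ringLmapEquivSelf A A W).symm.toLinearMap)
      refine ⟨a, fun w => ?_⟩
      have := LinearMap.congr_fun ha w
      simp only [LinearMap.smul_apply, LinearMap.id_apply] at this
      rw [this]
      simp only [LinearMap.comp_apply, LinearMap.lcomp_apply', LinearEquiv.coe_coe]
      congr 2
    choose a ha using hφ
    refine ⟨a, ?_⟩
    ext f
    have hf : f = ∑ j, (LinearMap.toSpanSingleton A W (f (Pi.single j 1))) ∘ₗ LinearMap.proj j := by
      ext j
      simp [Pi.single_apply]
    conv_rhs => rw [hf, map_sum]
    simp only [ha, LinearMap.applyₗ_apply_apply, ← map_smul, ← map_sum]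
    congr 1
    ext j
    simp [Finset.sum_apply, Pi.single_apply]

lemma WRefl.syzygy [IsNoetherianRing A] (hW : Semidual A W) (hG : WRefl A G W) {q : ℕ}
    {f : K →ₗ[A] (Fin q → A)} {g : (Fin q → A) →ₗ[A] G} (h : SES f g) : WRefl A K W where
  fin := Module.Finite.of_injective f h.inj
  ext i hi := h.subsingleton_left (subsingleton_ext_of_projective' hi) (hG.ext _ i.succ_pos)
  extDual i hi := by
    have hd := h.homPre W (hG.ext 1 one_pos)
    obtain ⟨i, rfl⟩ := Nat.exists_eq_succ_of_ne_zero hi.ne'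
    rcases Nat.eq_zero_or_pos i with rfl | hi'
    · refine hd.subsingleton_ext_one (hW.ext_piDual q one_pos) fun φ => ?_
      obtain ⟨x, rfl⟩ := hG.bij.2 φ
      obtain ⟨y, rfl⟩ := h.surj x
      exact ⟨evalW W _ y, rfl⟩
    · exact hd.subsingleton_right (hG.extDual i hi') (hW.ext_piDual q hi)
  bij := by
    have hd := h.homPre W (hG.ext 1 one_pos)
    have hF := hW.evalW_pi_bijective q
    constructor
    · intro x y hxy
      refine h.inj (hF.1 ?_)
      ext φ
      exact LinearMap.congr_fun hxy (φ ∘ₗ f)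
    · intro φ
      obtain ⟨y, hy⟩ := hF.2 (φ ∘ₗ homPre W f)
      have hgy : g y = 0 := by
        refine hG.bij.1 ?_
        ext ψ
        have := LinearMap.congr_fun hy (ψ ∘ₗ g)
        have h0 : (ψ ∘ₗ g) ∘ₗ f = 0 := by rw [LinearMap.comp_assoc, h.comp_eq_zero]; simp
        simp only [LinearMap.applyₗ_apply_apply, LinearMap.comp_apply, LinearMap.lcomp_apply', h0,
          map_zero] at this
        simpa using this
      obtain ⟨x, rfl⟩ := (h.exact y).mp hgy
      refine ⟨x, ?_⟩
      rw [← LinearMap.cancel_right hd.surj, ← hy]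
      rfl

lemma Semidual.nontrivial [Nontrivial A] (hW : Semidual A W) : Nontrivial W := by
  by_contra h
  rw [not_nontrivial_iff_subsingleton] at h
  exact zero_ne_one (hW.bij.1 (Subsingleton.elim ((0 : A) • LinearMap.id) ((1 : A) • LinearMap.id)))

lemma WRefl.projective [IsNoetherianRing A] [IsLocalRing A] (hW : Semidual A W) (d : ℕ) :
    ∀ (G : Type u) [AddCommGroup G] [Module A G] (_ : WRefl A G W)
    (_ : ∀ (H : Type u) [AddCommGroup H] [Module A H],
      (∀ i, 0 < i → Subsingleton (EMod A H W i)) →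
      ∀ i, d < i → Subsingleton (EMod A H (G →ₗ[A] W) i)), Module.Projective A G := by
  induction d with
  | zero =>
    intro G _ _ hG hd
    have := hG.fin
    obtain ⟨q, g, h⟩ := exists_cover A G
    have hK := hG.syzygy hW h
    have hs := h.homPre W (hG.ext 1 one_pos)
    obtain ⟨ρ, hρ⟩ := hs.exists_extension (hd _ hK.extDual 1 one_pos) LinearMap.id
    obtain ⟨s, hs'⟩ := hs.exists_desc (LinearMap.id - homPre W g ∘ₗ ρ) (by
      rw [LinearMap.sub_comp, LinearMap.comp_assoc, hρ, LinearMap.id_comp, LinearMap.comp_id,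
        sub_self])
    have hsec : homPre W (LinearMap.ker g).subtype ∘ₗ s = LinearMap.id := by
      rw [← LinearMap.cancel_right hs.surj, LinearMap.comp_assoc, hs', LinearMap.comp_sub,
        ← LinearMap.comp_assoc, hs.comp_eq_zero, LinearMap.zero_comp, sub_zero, LinearMap.comp_id,
        LinearMap.id_comp]
    let e := LinearEquiv.ofBijective _ hK.bij
    refine h.projective_of_retraction (e.symm.toLinearMap ∘ₗ homPre W s ∘ₗ evalW W _) ?_
    ext1 x
    simp only [LinearMap.comp_apply, LinearEquiv.coe_coe, LinearMap.id_apply]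
    rw [LinearEquiv.symm_apply_eq]
    ext κ
    exact LinearMap.congr_fun (LinearMap.congr_fun hsec κ) x
  | succ d ih =>
    intro G _ _ hG hd
    have := hG.fin
    have := hW.fin
    have := hW.nontrivial
    obtain ⟨q, g, h⟩ := exists_cover A G
    have hK := hG.syzygy hW h
    have := hK.fin
    have hs := h.homPre W (hG.ext 1 one_pos)
    have : Module.Projective A (LinearMap.ker g) := ih _ hK fun H _ _ hH i hi =>
      hs.subsingleton_covariant (subsingleton_ext_congr_right
        (LinearEquiv.piRing A W (Fin q) A).symm
        (subsingleton_ext_pi_right q (hH i (by omega)))) (hd H hH (i + 1) (by omega))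
    have : Module.Free A (LinearMap.ker g) := Module.free_of_flat_of_isLocalRing
    obtain ⟨r, hr⟩ := exists_retraction_of_extension (W := W) (LinearMap.ker g).subtype
      fun φ => h.exists_extension (hG.ext 1 one_pos) φ
    exact h.projective_of_retraction r hr

/-- Over a local ring of finite self-injective dimension, semidualizing modules are free. -/
theorem Semidual.nonempty_equiv [IsNoetherianRing A] [IsLocalRing A] (hW : Semidual A W) {d : ℕ}
    (hA : ∀ (H : Type u) [AddCommGroup H] [Module A H] (i : ℕ), d < i →
      Subsingleton (EMod A H A i)) : Nonempty (W ≃ₗ[A] A) := by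
  have := hW.fin
  have := hW.nontrivial
  let e : A ≃ₗ[A] (W →ₗ[A] W) :=
    LinearEquiv.ofBijective (LinearMap.toSpanSingleton A _ LinearMap.id) hW.bij
  have hWW : WRefl A W W :=
    { fin := hW.fin
      ext := hW.ext
      extDual := fun i hi => subsingleton_ext_congr e (subsingleton_ext_of_projective' hi)
      bij := by
        constructor
        · intro x y hxy
          exact LinearMap.congr_fun hxy LinearMap.id
        · intro φ
          refine ⟨φ LinearMap.id, ?_⟩
          ext f
          obtain ⟨a, rfl⟩ := hW.bij.2 f
          simp }
  have : Module.Projective A W := WRefl.projective hW d W hWW fun H _ _ _ i hi =>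
    subsingleton_ext_congr_right e (hA H i hi)
  have : Module.Free A W := Module.free_of_flat_of_isLocalRing
  let b := Module.Free.chooseBasis A W
  have hne : Nonempty (Module.Free.ChooseBasisIndex A W) := b.index_nonempty
  obtain ⟨i⟩ := hne
  have hsub : ∀ j, j = i := by
    intro j
    by_contra hj
    obtain ⟨a, ha⟩ := hW.bij.2 ((LinearMap.toSpanSingleton A W (b i)) ∘ₗ b.coord i)
    have h1 := congrArg (b.coord i) (LinearMap.congr_fun ha (b i))
    have h2 := congrArg (b.coord j) (LinearMap.congr_fun ha (b j))
    simp [hj] at h1 h2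
    rw [h1] at h2
    exact one_ne_zero h2
  have : Unique (Module.Free.ChooseBasisIndex A W) := ⟨⟨i⟩, hsub⟩
  exact ⟨b.equivFun.trans (LinearEquiv.funUnique _ A A)⟩

end Semidualizing

section PerfectQuotient

variable {R S : Type u} [CommRing R] [CommRing S] [Algebra R S]

variable (R S) in
/-- `S` is a perfect `R`-module of grade `c`. -/
structure PerfectAlg (c : ℕ) : Prop where
  pd : ∀ (V : Type u) [AddCommGroup V] [Module R V] (j : ℕ), c < j → Subsingleton (EMod R S V j)
  lt : ∀ i < c, Subsingleton (EMod R S R i)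

variable {c : ℕ}

lemma PerfectAlg.ne (h : PerfectAlg R S c) (i : ℕ) (hi : i ≠ c) :
    Subsingleton (EMod R S R i) := by
  rcases lt_or_gt_of_ne hi with hi | hi
  · exact h.lt i hi
  · exact h.pd R i hi

lemma PerfectAlg.finite_canMod [IsNoetherianRing R] [Module.Finite R S] :
    Module.Finite S (CanMod R S c) := by
  have : Module.Finite R (CanMod R S c) :=
    ModuleCat.finite_ext R (ModuleCat.of R S) (ModuleCat.of R R) c
  exact Module.Finite.of_restrictScalars_finite R S _

lemma PerfectAlg.semidual [IsNoetherianRing R] [IsNoetherianRing S] [Module.Finite R S]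
    (hsurj : Function.Surjective (algebraMap R S)) (h : PerfectAlg R S c) :
    Semidual S (CanMod R S c) := by
  have hfin := PerfectAlg.finite_canMod (R := R) (S := S) (c := c)
  have htop := topExt_canMod (R := R) (S := S) h.pd h.lt
  refine ⟨hfin, fun i hi => ?_, ?_⟩
  · obtain ⟨i, rfl⟩ := Nat.exists_eq_succ_of_ne_zero hi.ne'
    exact subsingleton_ext_canMod h.ne i _ htop.1
  · obtain ⟨e₀⟩ := htop.2
    let e : (CanMod R S c →ₗ[S] CanMod R S c) ≃ₗ[R] S :=
      (LinearEquiv.ofBijective _ (extEv_bijective (S := S) h.lt)).symm.trans e₀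
    have he : ∀ (s : S) (φ : CanMod R S c →ₗ[S] CanMod R S c), e (s • φ) = s * e φ := by
      intro s φ
      obtain ⟨r, rfl⟩ := hsurj s
      rw [algebraMap_smul, map_smul, Algebra.smul_def]
    obtain ⟨φ, hφ⟩ := e.surjective 1
    have hgen : ∀ ψ, ψ = e ψ • φ := fun ψ => e.injective (by rw [he, hφ, mul_one])
    have hv : e LinearMap.id * e (φ ∘ₗ φ) = 1 := by
      have : φ = (e LinearMap.id * e (φ ∘ₗ φ)) • φ := by
        rw [mul_smul, ← hgen (φ ∘ₗ φ), ← LinearMap.smul_comp, ← hgen LinearMap.id]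
        rfl
      have h2 := congrArg e this
      rw [he, hφ, mul_one] at h2
      exact h2.symm
    have hmul : ∀ s : S, e (s • LinearMap.id) = s * e LinearMap.id := fun s => he s _
    constructor
    · intro s t hst
      have : s * e LinearMap.id = t * e LinearMap.id := by
        rw [← hmul, ← hmul]; exact congrArg e hst
      calc s = s * e LinearMap.id * e (φ ∘ₗ φ) := by rw [mul_assoc, hv, mul_one]
        _ = t := by rw [this, mul_assoc, hv, mul_one]
    · intro ψ
      refine ⟨e ψ * e (φ ∘ₗ φ), e.injective ?_⟩
      change e ((e ψ * e (φ ∘ₗ φ)) • LinearMap.id) = e ψ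
      rw [hmul, mul_assoc, mul_comm (e (φ ∘ₗ φ)), hv, mul_one]

lemma PerfectAlg.nonempty_canMod_equiv [IsNoetherianRing R] [IsNoetherianRing S] [IsLocalRing S]
    [Module.Finite R S] (hsurj : Function.Surjective (algebraMap R S)) (h : PerfectAlg R S c)
    (hinj : HasFiniteInjDim S (ModuleCat.of S S)) : Nonempty (CanMod R S c ≃ₗ[S] S) := by
  obtain ⟨d, hd⟩ := exists_subsingleton_ext_of_finiteInjDim hinj
  exact (h.semidual hsurj).nonempty_equiv (d := d) fun H _ _ i hi => hd (ModuleCat.of S H) i hi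

lemma IsLambdaOf.exists_ses [IsLocalRing S] {L N : Type u} [AddCommGroup L] [Module S L]
    [AddCommGroup N] [Module S N] (h : IsLambdaOf S N L) :
    ∃ (q : ℕ) (p : (Fin q → S) →ₗ[S] N) (f : (N →ₗ[S] S) →ₗ[S] (Fin q → S))
      (g : (Fin q → S) →ₗ[S] L), Function.Surjective p ∧
      f = (LinearEquiv.piRing S S (Fin q) S).toLinearMap ∘ₗ homPre S p ∧ SES f g := by
  obtain ⟨n₀, n₁, g, f, hg, hfg, -, -, ⟨e⟩⟩ := h
  let r := (LinearEquiv.piRing S S (Fin n₀) S)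
  refine ⟨n₀, g, _, e.symm.toLinearMap ∘ₗ f.dualMap.rangeRestrict ∘ₗ r.symm.toLinearMap, hg, rfl,
    ?_, ?_, ?_⟩
  · exact r.injective.comp (LinearMap.dualMap_injective_of_surjective hg)
  · intro x
    obtain ⟨φ, rfl⟩ := r.surjective x
    simp only [LinearMap.comp_apply, LinearEquiv.coe_coe, LinearEquiv.symm_apply_apply,
      LinearEquiv.map_eq_zero_iff, Set.mem_range]
    rw [← Subtype.coe_inj]
    change f.dualMap φ = 0 ↔ _
    constructor
    · intro hφ
      obtain ⟨ψ, hψ⟩ := (SES.ker g hg).exists_desc φ (by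
        ext ⟨y, hy⟩
        rw [← hfg] at hy
        obtain ⟨z, rfl⟩ := hy
        exact LinearMap.congr_fun hφ z)
      exact ⟨ψ, congrArg r hψ⟩
    · rintro ⟨ψ, hψ⟩
      obtain rfl : homPre S g ψ = φ := r.injective hψ
      refine LinearMap.ext fun z => ?_
      have : g (f z) = 0 := by
        have : f z ∈ LinearMap.ker g := hfg ▸ ⟨z, rfl⟩
        exact this
      change ψ (g (f z)) = 0
      rw [this, map_zero]
  · exact e.symm.surjective.comp (f.dualMap.surjective_rangeRestrict.comp r.symm.surjective)

variable [IsNoetherianRing S] {L N X Y : Type u} [AddCommGroup L] [Module R L] [Module S L]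
  [IsScalarTower R S L] [Module.Finite S L]
  [AddCommGroup N] [Module R N] [Module S N] [IsScalarTower R S N] [Module.Finite S N]
  [AddCommGroup X] [Module R X] [Module S X] [IsScalarTower R S X] [Module.Finite S X]
  [AddCommGroup Y] [Module R Y] [Module S Y] [IsScalarTower R S Y] [Module.Finite S Y]

/-- `Ext^c_R(L, R)` is the `S`-dual of `L`. -/
def PerfectAlg.extEquiv (h : PerfectAlg R S c) (e : CanMod R S c ≃ₗ[S] S) (L : Type u)
    [AddCommGroup L] [Module R L] [Module S L] [IsScalarTower R S L] [Module.Finite S L] :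
    EMod R L R c ≃ₗ[R] (L →ₗ[S] S) :=
  (LinearEquiv.ofBijective _ (extEv_bijective (S := S) h.lt)).trans
    ((LinearEquiv.congrRight e).restrictScalars R)

lemma PerfectAlg.subsingleton_ext_self (h : PerfectAlg R S c) (e : CanMod R S c ≃ₗ[S] S)
    (hL : ∀ j, c < j → Subsingleton (EMod R L R j)) (i : ℕ) (hi : 0 < i) :
    Subsingleton (EMod S L S i) := by
  obtain ⟨i, rfl⟩ := Nat.exists_eq_succ_of_ne_zero hi.ne'
  exact subsingleton_ext_congr_right e (subsingleton_ext_canMod h.ne i L hL)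

lemma PerfectAlg.subsingleton_ext_dual (h : PerfectAlg R S c) {d : ℕ}
    (hd : ∀ (H : Type u) [AddCommGroup H] [Module R H] (i : ℕ), d < i →
      Subsingleton (EMod R H R i)) (k : ℕ) : ∀ (G : Type u) [AddCommGroup G] [Module S G]
      [Module.Finite S G], (∀ i, 0 < i → Subsingleton (EMod S G S i)) →
      ∀ i, c < i → d < i + k → Subsingleton (EMod R (G →ₗ[S] S) R i) := by
  induction k with
  | zero => intro G _ _ _ _ i _ hi; exact hd _ i hi
  | succ k ih =>
    intro G _ _ _ hG i hci hi
    obtain ⟨q, g, hg⟩ := exists_cover S G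
    have hs := (hg.homPre S (hG 1 one_pos)).restrictScalars (R := R)
    refine hs.subsingleton_left ?_ (ih _ (fun j hj => hg.subsingleton_left
      (subsingleton_ext_of_projective' hj) (hG (j + 1) j.succ_pos)) (i + 1) (by omega) (by omega))
    exact subsingleton_ext_congr ((LinearEquiv.piRing S S (Fin q) S).symm.restrictScalars R)
      (subsingleton_ext_pi q (h.pd R i hci))

lemma PerfectAlg.exists_ses (h : PerfectAlg R S c) (e : CanMod R S c ≃ₗ[S] S) [IsLocalRing S]
    {H : Type u} [AddCommGroup H] [Module R H] [Module S H] [IsScalarTower R S H]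
    (hl : IsLambdaOf S N H) :
    ∃ (q : ℕ) (f : EMod R N R c →ₗ[R] (Fin q → S)) (g : (Fin q → S) →ₗ[R] H), SES f g := by
  obtain ⟨q, -, f, g, -, -, hfg⟩ := hl.exists_ses
  have hfg := hfg.restrictScalars (R := R)
  refine ⟨q, f.restrictScalars R ∘ₗ (h.extEquiv e N).toLinearMap, g.restrictScalars R,
    hfg.inj.comp (h.extEquiv e N).injective, ?_, hfg.surj⟩
  intro x
  refine (hfg.exact x).trans ⟨?_, ?_⟩
  · rintro ⟨y, rfl⟩
    exact ⟨(h.extEquiv e N).symm y, by simp⟩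
  · rintro ⟨y, rfl⟩
    exact ⟨h.extEquiv e N y, rfl⟩

/-- Vanishing of `Ext` passes to the linked module. -/
lemma PerfectAlg.subsingleton_ext_of_isLambdaOf (h : PerfectAlg R S c) (e : CanMod R S c ≃ₗ[S] S)
    [IsLocalRing S] (hR : HasFiniteInjDim R (ModuleCat.of R R)) (hl : IsLambdaOf S X Y)
    (hX : ∀ j, c < j → Subsingleton (EMod R X R j)) (i : ℕ) (hi : i ≠ c) :
    Subsingleton (EMod R Y R i) := by
  rcases lt_or_gt_of_ne hi with hi | hi
  · exact subsingleton_ext_of_lt (V := R) h.lt i hi Y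
  · obtain ⟨d, hd⟩ := exists_subsingleton_ext_of_finiteInjDim hR
    obtain ⟨q, p, f, g, hp, rfl, hfg⟩ := hl.exists_ses
    have hXS := h.subsingleton_ext_self e hX
    have hs := SES.ker p hp
    have hdual := hs.homPre S (hXS 1 one_pos)
    let r := (LinearEquiv.piRing S S (Fin q) S)
    have hdual' : SES (homPre S p) (g ∘ₗ r.toLinearMap) := by
      refine ⟨hdual.inj, ?_, hfg.surj.comp r.surjective⟩
      intro φ
      refine (hfg.exact (r φ)).trans ⟨?_, ?_⟩
      · rintro ⟨ψ, hψ⟩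
        exact ⟨ψ, r.injective hψ⟩
      · rintro ⟨ψ, rfl⟩
        exact ⟨ψ, rfl⟩
    let e' : (LinearMap.ker p →ₗ[S] S) ≃ₗ[S] Y :=
      (hdual.exact.linearEquivOfSurjective hdual.surj).symm.trans
        (hdual'.exact.linearEquivOfSurjective hdual'.surj)
    exact subsingleton_ext_congr (e'.restrictScalars R) (h.subsingleton_ext_dual
      (fun H _ _ i hi => hd (ModuleCat.of R H) i hi) d _ (fun j hj => hs.subsingleton_left
      (subsingleton_ext_of_projective' hj) (hXS (j + 1) j.succ_pos)) i hi (by omega))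

lemma PerfectAlg.eq_of_isLambdaOf (h : PerfectAlg R S c) (e : CanMod R S c ≃ₗ[S] S)
    [IsLocalRing S] {H : Type u} [AddCommGroup H] [Module S H] (hl : IsLambdaOf S H L) {n : ℕ}
    (hlt : ∀ i < n, Subsingleton (EMod R L R i)) (hn : ¬ Subsingleton (EMod R L R n)) : n = c := by
  refine le_antisymm ?_ ?_
  · by_contra! hc
    have hcL : Subsingleton (L →ₗ[S] S) :=
      (h.extEquiv e L).symm.toEquiv.subsingleton_congr.mpr (hlt c hc)
    refine hn ?_
    have : Subsingleton L := by
      obtain ⟨n₀, n₁, g, f, -, -, -, -, ⟨e₁⟩⟩ := hl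
      refine subsingleton_of_forall_eq 0 fun x => e₁.injective (Subtype.ext ?_)
      ext j
      have := LinearMap.congr_fun (Subsingleton.elim ((LinearMap.applyₗ (Pi.single j 1)) ∘ₗ
        (LinearMap.range f.dualMap).subtype ∘ₗ e₁.toLinearMap) (0 : L →ₗ[S] S)) x
      simpa using this
    exact subsingleton_ext_of_subsingleton n
  · by_contra! hc
    exact hn (subsingleton_ext_of_lt (V := R) h.lt n hc L)

lemma exists_perfectAlg {a : Ideal R} [IsNoetherianRing (R ⧸ a)] (ha : IsPerfectIdeal R a)
    (M : Type u) [AddCommGroup M] [Module R M] [Module (R ⧸ a) M] [IsScalarTower R (R ⧸ a) M]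
    [Module.Finite (R ⧸ a) M] {n : ℕ} (hn : gradeM R (ModuleCat.of R M) = n) :
    ∃ c, PerfectAlg R (R ⧸ a) c := by
  rcases eq_or_ne (pdim R (ModuleCat.of R (R ⧸ a))) ⊤ with ht | ht
  · have h0 : ∀ i < n + 1, Subsingleton (EMod R (R ⧸ a) R i) :=
      (le_gradeM_iff _ (n + 1)).mp (by rw [show gradeM R _ = _ from ha, ht]; exact le_top)
    exact absurd (subsingleton_ext_of_lt (V := R) h0 n n.lt_succ_self M)
      (not_subsingleton_of_gradeM_eq hn)
  · obtain ⟨c, hc⟩ := ENat.ne_top_iff_exists.mp ht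
    refine ⟨c, fun V _ _ j hj => ?_, (le_gradeM_iff _ c).mp (by
      rw [show gradeM R _ = _ from ha, hc])⟩
    exact subsingleton_ext_of_pdLE (enat_sInf_eq_coe hc.symm) (ModuleCat.of R V) hj

end PerfectQuotient

section Linked

variable {R : Type u} [CommRing R] {a : Ideal R} [IsLocalRing (R ⧸ a)] {M N : Type u}
  [AddCommGroup M] [Module R M] [Module.Finite R M]
  [Module (R ⧸ a) M] [IsScalarTower R (R ⧸ a) M]
  [AddCommGroup N] [Module R N] [Module.Finite R N]
  [Module (R ⧸ a) N] [IsScalarTower R (R ⧸ a) N]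

/-- The consequences of linkage for Cohen-Macaulay modules over a Gorenstein ring. -/
theorem LinkedBy.exists_data [IsNoetherianRing R] (hR : HasFiniteInjDim R (ModuleCat.of R R))
    (ha₁ : IsGorensteinLocalRing (R ⧸ a)) (ha₂ : IsPerfectIdeal R a) {n : ℕ}
    (hperf : IsGPerfect R (ModuleCat.of R M)) (hdim : gdim R (ModuleCat.of R M) = (n : ℕ∞))
    (hMN : LinkedBy R a M N) :
    (∀ (V : Type u) [AddCommGroup V] [Module R V] (j : ℕ), n < j →
      Subsingleton (EMod R (R ⧸ a) V j)) ∧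
    (∀ i, i ≠ n → Subsingleton (EMod R M R i)) ∧ (∀ i, i ≠ n → Subsingleton (EMod R N R i)) ∧
    (∃ (q : ℕ) (f : EMod R M R n →ₗ[R] (Fin q → R ⧸ a)) (g : (Fin q → R ⧸ a) →ₗ[R] N),
      SES f g) ∧
    (∃ (q : ℕ) (f : EMod R N R n →ₗ[R] (Fin q → R ⧸ a)) (g : (Fin q → R ⧸ a) →ₗ[R] M),
      SES f g) := by
  have := ha₁.2.1
  have : Module.Finite (R ⧸ a) M := Module.Finite.of_restrictScalars_finite R _ _
  have : Module.Finite (R ⧸ a) N := Module.Finite.of_restrictScalars_finite R _ _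
  have hgrade : gradeM R (ModuleCat.of R M) = n := hperf.trans hdim
  have hlt : ∀ i < n, Subsingleton (EMod R M R i) := (le_gradeM_iff _ n).mp hgrade.ge
  have hgt : ∀ i, n < i → Subsingleton (EMod R M R i) := fun i hi =>
    subsingleton_ext_of_gdimLE (gdimLE_of_gdim_eq hdim) hi
  obtain ⟨c, hc⟩ := exists_perfectAlg ha₂ M hgrade
  obtain ⟨e⟩ := hc.nonempty_canMod_equiv Ideal.Quotient.mk_surjective ha₁.2.2
  obtain rfl := hc.eq_of_isLambdaOf e hMN.1 hlt (not_subsingleton_of_gradeM_eq hgrade)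
  refine ⟨hc.pd, fun i hi => ?_, hc.subsingleton_ext_of_isLambdaOf e hR hMN.2 hgt,
    hc.exists_ses e hMN.2, hc.exists_ses e hMN.1⟩
  rcases lt_or_gt_of_ne hi with hi | hi
  · exact hlt i hi
  · exact hgt i hi

end Linked

section TateCohomology

variable {R : Type u} [CommRing R]

lemma nonempty_equiv_of_span {G A B : Type*} [AddCommGroup G] [Module R G] [AddCommGroup A]
    [Module R A] [AddCommGroup B] [Module R B] (p : G →ₗ[R] A) (q : G →ₗ[R] B)
    (hp : Function.Surjective p) (hq : Function.Surjective q) (h : ∀ x, p x = 0 ↔ q x = 0) :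
    Nonempty (A ≃ₗ[R] B) :=
  ⟨(p.quotKerEquivOfSurjective hp).symm.trans
    ((Submodule.quotEquivOfEq _ _ (Submodule.ext h)).trans (q.quotKerEquivOfSurjective hq))⟩

lemma SES.exists_factor {A B C W : Type u} [AddCommGroup A] [Module R A] [AddCommGroup B]
    [Module R B] [AddCommGroup C] [Module R C] [AddCommGroup W] [Module R W] {f : A →ₗ[R] B}
    {g : B →ₗ[R] C} (h : SES f g) (φ : W →ₗ[R] B) (hφ : g ∘ₗ φ = 0) :
    ∃ ψ : W →ₗ[R] A, f ∘ₗ ψ = φ := by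
  have hr : ∀ x, φ x ∈ LinearMap.range f := fun x =>
    (h.exact (φ x)).mp (LinearMap.congr_fun hφ x)
  refine ⟨(LinearEquiv.ofInjective f h.inj).symm.toLinearMap ∘ₗ φ.codRestrict _ hr, ?_⟩
  ext x
  exact congrArg Subtype.val ((LinearEquiv.ofInjective f h.inj).apply_symm_apply ⟨φ x, hr x⟩)

variable (T : ChainComplex (ModuleCat.{u} R) ℤ) {A B C V W : Type u} [AddCommGroup A] [Module R A]
  [AddCommGroup B] [Module R B] [AddCommGroup C] [Module R C] [AddCommGroup V] [Module R V]
  [AddCommGroup W] [Module R W]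

/-- The cocycles of `Hom(T, V)`. -/
def cocyc (V : Type u) [AddCommGroup V] [Module R V] (j : ℤ) : Submodule R (T.X j →ₗ[R] V) :=
  LinearMap.ker (homPre V (T.d (j + 1) j).hom)

instance (V : Type u) [AddCommGroup V] [Module R V] (j : ℤ) : AddCommGroup (cocyc T V j) :=
  Submodule.addCommGroup _

/-- The coboundaries of `Hom(T, V)`. -/
def cobd (V : Type u) [AddCommGroup V] [Module R V] (j : ℤ) : Submodule R (T.X j →ₗ[R] V) :=
  LinearMap.range (homPre V (T.d j (j - 1)).hom)

/-- The cohomology of `Hom(T, V)`. -/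
def HomCoh (V : Type u) [AddCommGroup V] [Module R V] (j : ℤ) : Type u :=
  cocyc T V j ⧸ (cobd T V j).submoduleOf (cocyc T V j)

instance (V : Type u) [AddCommGroup V] [Module R V] (j : ℤ) : AddCommGroup (HomCoh T V j) :=
  inferInstanceAs (AddCommGroup (cocyc T V j ⧸ (cobd T V j).submoduleOf (cocyc T V j)))

instance (V : Type u) [AddCommGroup V] [Module R V] (j : ℤ) : Module R (HomCoh T V j) :=
  inferInstanceAs (Module R (cocyc T V j ⧸ (cobd T V j).submoduleOf (cocyc T V j)))

variable {T}

lemma mem_cocyc {j k : ℤ} (h : j + 1 = k) {f : T.X j →ₗ[R] V} :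
    f ∈ cocyc T V j ↔ f ∘ₗ (T.d k j).hom = 0 := by
  subst h; rfl

lemma mem_cobd {i j : ℤ} (h : i + 1 = j) {f : T.X j →ₗ[R] V} :
    f ∈ cobd T V j ↔ ∃ g : T.X i →ₗ[R] V, g ∘ₗ (T.d j i).hom = f := by
  obtain rfl : i = j - 1 := by omega
  rfl

lemma d_comp_d_hom (i j k : ℤ) : (T.d j i).hom ∘ₗ (T.d k j).hom = 0 := by
  rw [← ModuleCat.hom_comp, T.d_comp_d]; rfl

lemma comp_d_mem_cocyc {i j : ℤ} (g : T.X i →ₗ[R] V) : g ∘ₗ (T.d j i).hom ∈ cocyc T V j := by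
  rw [mem_cocyc rfl, LinearMap.comp_assoc, d_comp_d_hom, LinearMap.comp_zero]

lemma comp_mem_cocyc {j : ℤ} (e : V →ₗ[R] W) {f : T.X j →ₗ[R] V} (hf : f ∈ cocyc T V j) :
    e ∘ₗ f ∈ cocyc T W j := by
  rw [mem_cocyc rfl] at hf ⊢
  rw [LinearMap.comp_assoc, hf, LinearMap.comp_zero]

/-- The class of a family of cocycles. -/
def homCohMk {G : Type u} [AddCommGroup G] [Module R G] {j : ℤ} (p : G →ₗ[R] (T.X j →ₗ[R] V))
    (hp : ∀ x, p x ∈ cocyc T V j) : G →ₗ[R] HomCoh T V j :=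
  ((cobd T V j).submoduleOf (cocyc T V j)).mkQ ∘ₗ p.codRestrict _ hp

lemma homCohMk_eq_zero {G : Type u} [AddCommGroup G] [Module R G] {i j : ℤ} (h : i + 1 = j)
    (p : G →ₗ[R] (T.X j →ₗ[R] V)) (hp : ∀ x, p x ∈ cocyc T V j) (x : G) :
    homCohMk p hp x = 0 ↔ ∃ g : T.X i →ₗ[R] V, g ∘ₗ (T.d j i).hom = p x := by
  rw [← mem_cobd h]
  exact Submodule.Quotient.mk_eq_zero _

lemma homCohMk_surjective {G : Type u} [AddCommGroup G] [Module R G] {j : ℤ}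
    (p : G →ₗ[R] (T.X j →ₗ[R] V)) (hp : ∀ x, p x ∈ cocyc T V j)
    (h : ∀ f ∈ cocyc T V j, ∃ x, p x = f) : Function.Surjective (homCohMk p hp) := by
  intro y
  obtain ⟨⟨f, hf⟩, rfl⟩ := Submodule.mkQ_surjective _ y
  obtain ⟨x, rfl⟩ := h f hf
  exact ⟨x, rfl⟩

lemma HomCoh.nonempty_equiv_of_span {G : Type u} [AddCommGroup G] [Module R G]
    {T' : ChainComplex (ModuleCat.{u} R) ℤ} {i j i' j' : ℤ} (hij : i + 1 = j) (hij' : i' + 1 = j')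
    (p : G →ₗ[R] (T.X j →ₗ[R] V)) (q : G →ₗ[R] (T'.X j' →ₗ[R] W))
    (hp : ∀ x, p x ∈ cocyc T V j) (hq : ∀ x, q x ∈ cocyc T' W j')
    (hps : ∀ f ∈ cocyc T V j, ∃ x, p x = f) (hqs : ∀ f ∈ cocyc T' W j', ∃ x, q x = f)
    (h : ∀ x, (∃ g : T.X i →ₗ[R] V, g ∘ₗ (T.d j i).hom = p x) ↔
      ∃ g : T'.X i' →ₗ[R] W, g ∘ₗ (T'.d j' i').hom = q x) :
    Nonempty (HomCoh T V j ≃ₗ[R] HomCoh T' W j') :=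
  _root_.nonempty_equiv_of_span (homCohMk p hp) (homCohMk q hq) (homCohMk_surjective p hp hps)
    (homCohMk_surjective q hq hqs)
    (fun x => by rw [homCohMk_eq_zero hij, homCohMk_eq_zero hij', h])

lemma nonempty_homology_equiv_homCoh (V : Type u) [AddCommGroup V] [Module R V] (j : ℤ) :
    Nonempty ((T.linearYonedaObj R (ModuleCat.of R V)).homology j ≃ₗ[R] HomCoh T V j) := by
  let K := (T.linearYonedaObj R (ModuleCat.of R V)).sc' (j - 1) j (j + 1)
  let e : (T.linearYonedaObj R (ModuleCat.of R V)).homology j ≅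
      ModuleCat.of R (LinearMap.ker K.g.hom ⧸ LinearMap.range K.moduleCatToCycles) :=
    (HomologicalComplex.homologyIsoSc' _ (j - 1) j (j + 1) (by simp) (by simp)) ≪≫
      K.moduleCatHomologyIso
  let φ : LinearMap.ker K.g.hom →ₗ[R] (T.X j →ₗ[R] V) :=
    (ModuleCat.homLinearEquiv (S := R) (M := T.X j) (N := ModuleCat.of R V)).toLinearMap ∘ₗ
      (LinearMap.ker K.g.hom).subtype
  have hφ : ∀ x, φ x ∈ cocyc T V j := fun x => congrArg ModuleCat.Hom.hom x.2
  obtain ⟨e'⟩ := nonempty_equiv_of_span (LinearMap.range K.moduleCatToCycles).mkQ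
    (homCohMk φ hφ) (Submodule.mkQ_surjective _)
    (homCohMk_surjective _ _ fun f hf => ⟨⟨ModuleCat.ofHom f, ModuleCat.hom_ext hf⟩, rfl⟩) (by
      intro x
      rw [homCohMk_eq_zero (sub_add_cancel j 1)]
      refine (Submodule.Quotient.mk_eq_zero _).trans ⟨?_, ?_⟩
      · rintro ⟨y, rfl⟩
        exact ⟨ModuleCat.Hom.hom y, rfl⟩
      · rintro ⟨g, hg⟩
        exact ⟨ModuleCat.ofHom g, Subtype.ext (ModuleCat.hom_ext hg)⟩)
  exact ⟨e.toLinearEquiv.trans e'⟩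

lemma HomCoh.nonempty_congr (e : V ≃ₗ[R] W) (j : ℤ) :
    Nonempty (HomCoh T V j ≃ₗ[R] HomCoh T W j) := by
  refine HomCoh.nonempty_equiv_of_span (sub_add_cancel j 1) (sub_add_cancel j 1)
    (cocyc T V j).subtype (LinearMap.compRight R e.toLinearMap ∘ₗ (cocyc T V j).subtype)
    (fun x => x.2) (fun x => comp_mem_cocyc _ x.2) (fun f hf => ⟨⟨f, hf⟩, rfl⟩) (fun f hf => ?_)
    (fun x => ⟨?_, ?_⟩)
  · refine ⟨⟨e.symm.toLinearMap ∘ₗ f, comp_mem_cocyc _ hf⟩, ?_⟩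
    ext y; simp
  · rintro ⟨g, hg⟩
    refine ⟨e.toLinearMap ∘ₗ g, ?_⟩
    rw [LinearMap.comp_assoc, hg]; rfl
  · rintro ⟨g, hg⟩
    refine ⟨e.symm.toLinearMap ∘ₗ g, ?_⟩
    rw [LinearMap.comp_assoc, hg]
    ext y; simp

variable (T V) in
/-- `Hom(T, V)` is acyclic. -/
def HomAcyclic : Prop :=
  ∀ (i j : ℤ), i + 1 = j → ∀ f ∈ cocyc T V j, ∃ g : T.X i →ₗ[R] V, g ∘ₗ (T.d j i).hom = f

lemma HomAcyclic.of_retract (h : HomAcyclic T W) (s : V →ₗ[R] W) (r : W →ₗ[R] V)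
    (hrs : r ∘ₗ s = LinearMap.id) : HomAcyclic T V := by
  intro i j hij f hf
  obtain ⟨g, hg⟩ := h i j hij _ (comp_mem_cocyc s hf)
  refine ⟨r ∘ₗ g, ?_⟩
  rw [LinearMap.comp_assoc, hg, ← LinearMap.comp_assoc, hrs, LinearMap.id_comp]

lemma HomAcyclic.of_subsingleton [Subsingleton V] : HomAcyclic T V := fun _ _ _ _ _ =>
  ⟨0, LinearMap.ext fun _ => Subsingleton.elim _ _⟩

lemma HomAcyclic.pi (h : HomAcyclic T V) (k : ℕ) : HomAcyclic T (Fin k → V) := by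
  intro i j hij f hf
  choose g hg using fun l : Fin k => h i j hij _ (comp_mem_cocyc (LinearMap.proj l) hf)
  refine ⟨LinearMap.pi g, ?_⟩
  ext x l
  exact LinearMap.congr_fun (hg l) x

lemma HomAcyclic.of_projective (h : HomAcyclic T R) [Module.Finite R V] [Module.Projective R V] :
    HomAcyclic T V := by
  obtain ⟨k, g, hg⟩ := exists_cover R V
  obtain ⟨s, hs⟩ := Module.projective_lifting_property g LinearMap.id hg.surj
  exact (h.pi k).of_retract s g hs

section Sequences

variable {f : A →ₗ[R] B} {g : B →ₗ[R] C} [∀ i, Module.Projective R (T.X i)]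

lemma SES.exists_cocyc_lift (h : SES f g) (hA : HomAcyclic T A) (j : ℤ) (c : T.X j →ₗ[R] C)
    (hc : c ∈ cocyc T C j) : ∃ b ∈ cocyc T B j, g ∘ₗ b = c := by
  obtain ⟨b, rfl⟩ := Module.projective_lifting_property g c h.surj
  obtain ⟨a, ha⟩ := h.exists_factor (b ∘ₗ (T.d (j + 1) j).hom) (by
    rw [← LinearMap.comp_assoc]; exact (mem_cocyc rfl).mp hc)
  obtain ⟨a', rfl⟩ := hA j (j + 1) rfl a ((mem_cocyc rfl).mpr (by
    rw [← LinearMap.cancel_left h.inj, ← LinearMap.comp_assoc, ha, LinearMap.comp_assoc,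
      d_comp_d_hom, LinearMap.comp_zero, LinearMap.comp_zero]))
  refine ⟨b - f ∘ₗ a', (mem_cocyc rfl).mpr ?_, ?_⟩
  · rw [LinearMap.sub_comp, LinearMap.comp_assoc, ha, sub_self]
  · rw [LinearMap.comp_sub, ← LinearMap.comp_assoc, h.comp_eq_zero, LinearMap.zero_comp, sub_zero]

lemma SES.homAcyclic_right (h : SES f g) (hA : HomAcyclic T A) (hB : HomAcyclic T B) :
    HomAcyclic T C := by
  intro i j hij c hc
  obtain ⟨b, hb, rfl⟩ := h.exists_cocyc_lift hA j c hc
  obtain ⟨b', rfl⟩ := hB i j hij b hb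
  exact ⟨g ∘ₗ b', rfl⟩

lemma SES.nonempty_homCoh_equiv (h : SES f g) (hA : HomAcyclic T A) (j : ℤ) :
    Nonempty (HomCoh T B j ≃ₗ[R] HomCoh T C j) := by
  refine HomCoh.nonempty_equiv_of_span (sub_add_cancel j 1) (sub_add_cancel j 1)
    (cocyc T B j).subtype (LinearMap.compRight R g ∘ₗ (cocyc T B j).subtype)
    (fun x => x.2) (fun x => comp_mem_cocyc _ x.2) (fun f hf => ⟨⟨f, hf⟩, rfl⟩) (fun c hc => ?_)
    (fun x => ⟨?_, ?_⟩)
  · obtain ⟨b, hb, rfl⟩ := h.exists_cocyc_lift hA j c hc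
    exact ⟨⟨b, hb⟩, rfl⟩
  · rintro ⟨b, hb⟩
    refine ⟨g ∘ₗ b, ?_⟩
    rw [LinearMap.comp_assoc, hb]; rfl
  · rintro ⟨c, hc⟩
    obtain ⟨b, rfl⟩ := Module.projective_lifting_property g c h.surj
    obtain ⟨a, ha⟩ := h.exists_factor (x.1 - b ∘ₗ (T.d j (j - 1)).hom) (by
      rw [LinearMap.comp_sub, ← LinearMap.comp_assoc, hc, sub_eq_zero]; rfl)
    obtain ⟨a', rfl⟩ := hA (j - 1) j (by omega) a ((mem_cocyc rfl).mpr (by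
      rw [← LinearMap.cancel_left h.inj, ← LinearMap.comp_assoc, ha, LinearMap.sub_comp,
        LinearMap.comp_assoc, d_comp_d_hom, (mem_cocyc rfl).mp x.2, LinearMap.comp_zero,
        LinearMap.comp_zero, sub_zero]))
    refine ⟨b + f ∘ₗ a', ?_⟩
    rw [LinearMap.add_comp, LinearMap.comp_assoc, ha, add_sub_cancel]; rfl

lemma SES.nonempty_homCoh_shift (h : SES f g) (hB : HomAcyclic T B) {j k : ℤ} (hjk : j + 1 = k) :
    Nonempty (HomCoh T C j ≃ₗ[R] HomCoh T A k) := by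
  let G : Submodule R ((T.X j →ₗ[R] B) × (T.X k →ₗ[R] A)) :=
    LinearMap.eqLocus (_root_.homPre B (T.d k j).hom ∘ₗ LinearMap.fst R _ _)
      (LinearMap.compRight R f ∘ₗ LinearMap.snd R _ _)
  have hG : ∀ x : G, x.1.1 ∘ₗ (T.d k j).hom = f ∘ₗ x.1.2 := fun x => x.2
  refine HomCoh.nonempty_equiv_of_span (sub_add_cancel j 1) hjk
    (LinearMap.compRight R g ∘ₗ LinearMap.fst R _ _ ∘ₗ G.subtype)
    (LinearMap.snd R _ _ ∘ₗ G.subtype) (fun x => (mem_cocyc hjk).mpr ?_)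
    (fun x => (mem_cocyc rfl).mpr ?_) (fun c hc => ?_) (fun a ha => ?_) (fun x => ⟨?_, ?_⟩)
  · change (g ∘ₗ x.1.1) ∘ₗ (T.d k j).hom = 0
    rw [LinearMap.comp_assoc, hG, ← LinearMap.comp_assoc, h.comp_eq_zero, LinearMap.zero_comp]
  · change x.1.2 ∘ₗ _ = 0
    rw [← LinearMap.cancel_left h.inj, ← LinearMap.comp_assoc, ← hG, LinearMap.comp_assoc,
      d_comp_d_hom, LinearMap.comp_zero, LinearMap.comp_zero]
  · obtain ⟨b, rfl⟩ := Module.projective_lifting_property g c h.surj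
    obtain ⟨a, ha⟩ := h.exists_factor (b ∘ₗ (T.d k j).hom) (by
      rw [← LinearMap.comp_assoc]; exact (mem_cocyc hjk).mp hc)
    exact ⟨⟨(b, a), ha.symm⟩, rfl⟩
  · obtain ⟨b, hb⟩ := hB j k hjk _ (comp_mem_cocyc f ha)
    exact ⟨⟨(b, a), hb⟩, rfl⟩
  · rintro ⟨c, hc⟩
    obtain ⟨b, rfl⟩ := Module.projective_lifting_property g c h.surj
    obtain ⟨a, ha⟩ := h.exists_factor (x.1.1 - b ∘ₗ (T.d j (j - 1)).hom) (by
      rw [LinearMap.comp_sub, ← LinearMap.comp_assoc, hc, sub_eq_zero]; rfl)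
    refine ⟨a, ?_⟩
    change a ∘ₗ _ = x.1.2
    rw [← LinearMap.cancel_left h.inj, ← LinearMap.comp_assoc, ha, LinearMap.sub_comp,
      LinearMap.comp_assoc, d_comp_d_hom, LinearMap.comp_zero, sub_zero, hG]
  · rintro ⟨a, ha⟩
    replace ha : a ∘ₗ (T.d k j).hom = x.1.2 := ha
    obtain ⟨b, hb⟩ := hB (j - 1) j (by omega) (x.1.1 - f ∘ₗ a) ((mem_cocyc hjk).mpr (by
      rw [LinearMap.sub_comp, hG, LinearMap.comp_assoc, ha, sub_self]))
    refine ⟨g ∘ₗ b, ?_⟩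
    rw [LinearMap.comp_assoc, hb, LinearMap.comp_sub, ← LinearMap.comp_assoc, h.comp_eq_zero,
      LinearMap.zero_comp, sub_zero]
    rfl

end Sequences

end TateCohomology

section ExtOfResolution

variable {R : Type u} [CommRing R] {P Q L V : Type u} [AddCommGroup P] [Module R P]
  [AddCommGroup Q] [Module R Q] [AddCommGroup L] [Module R L] [AddCommGroup V] [Module R V]

variable (V) in
/-- Maps out of a cokernel. -/
def descEquiv (d : Q →ₗ[R] P) (p : P →ₗ[R] L) (hp : Function.Surjective p)
    (hd : Function.Exact d p) : (L →ₗ[R] V) ≃ₗ[R] LinearMap.ker (homPre V d) :=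
  LinearEquiv.ofBijective ((homPre V p).codRestrict (LinearMap.ker (homPre V d)) (fun φ => by
    ext x
    change φ (p (d x)) = 0
    rw [hd.apply_apply_eq_zero, map_zero])) (by
    constructor
    · intro φ ψ h
      exact (LinearMap.cancel_right hp).mp (congrArg Subtype.val h)
    · rintro ⟨φ, hφ⟩
      obtain ⟨ψ, hψ⟩ := (SES.ker p hp).exists_desc φ (by
        ext ⟨x, hx⟩
        obtain ⟨y, rfl⟩ := (hd x).mp hx
        exact LinearMap.congr_fun hφ y)
      exact ⟨ψ, Subtype.ext hψ⟩)

lemma exists_ext_of_resolution (i : ℕ) : ∀ (P : ℕ → ModuleCat.{u} R)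
    (d : ∀ k, P (k + 1) →ₗ[R] P k) (L : Type u) [AddCommGroup L] [Module R L] (p : P 0 →ₗ[R] L),
    (∀ k, Module.Projective R (P k)) → Function.Surjective p → Function.Exact (d 0) p →
    (∀ k, Function.Exact (d (k + 1)) (d k)) →
    ∃ q : LinearMap.ker (homPre V (d (i + 1))) →ₗ[R] EMod R L V (i + 1),
      Function.Surjective q ∧ ∀ z, q z = 0 ↔ ∃ ψ : P i →ₗ[R] V, ψ ∘ₗ d i = z.1 := by
  induction i with
  | zero =>
    intro P d L _ _ p hP hp h0 hd
    have hs := SES.ker p hp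
    let r : P 1 →ₗ[R] LinearMap.ker p := (d 0).codRestrict _ fun x => h0.apply_apply_eq_zero x
    have hr : Function.Surjective r := by
      rintro ⟨x, hx⟩
      obtain ⟨y, rfl⟩ := (h0 x).mp hx
      exact ⟨y, rfl⟩
    have hdr : Function.Exact (d 1) r := fun x => Subtype.ext_iff.trans (hd 0 x)
    let Φ := descEquiv V (d 1) r hr hdr
    refine ⟨hs.δ V 0 ∘ₗ (extZero _ V).symm.toLinearMap ∘ₗ Φ.symm.toLinearMap, ?_, fun z => ?_⟩
    · intro x
      obtain ⟨y, rfl⟩ := (hs.exact_right V 0 x).mp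
        ((subsingleton_ext_of_projective (A := P 0) (V := V) 0).elim _ _)
      exact ⟨Φ (extZero _ V y), by simp⟩
    · obtain ⟨w, rfl⟩ := Φ.surjective z
      simp only [LinearMap.comp_apply, LinearEquiv.coe_coe, LinearEquiv.symm_apply_apply]
      refine (hs.exact_left V 0 _).trans ⟨?_, ?_⟩
      · rintro ⟨y, hy⟩
        refine ⟨extZero _ V y, ?_⟩
        have : extZero _ V y ∘ₗ (LinearMap.ker p).subtype = w := by
          rw [← extZero_extPre, hy]; simp
        rw [← this]
        rfl
      · rintro ⟨ψ, hψ⟩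
        refine ⟨(extZero _ V).symm ψ, ?_⟩
        rw [extPre_extZero_symm]
        congr 1
        exact (LinearMap.cancel_right hr).mp hψ
  | succ i ih =>
    intro P d L _ _ p hP hp h0 hd
    have hs := SES.ker p hp
    let r : P 1 →ₗ[R] LinearMap.ker p := (d 0).codRestrict _ fun x => h0.apply_apply_eq_zero x
    have hr : Function.Surjective r := by
      rintro ⟨x, hx⟩
      obtain ⟨y, rfl⟩ := (h0 x).mp hx
      exact ⟨y, rfl⟩
    have hdr : Function.Exact (d 1) r := fun x => Subtype.ext_iff.trans (hd 0 x)
    obtain ⟨q, hq, hz⟩ := ih (fun k => P (k + 1)) (fun k => d (k + 1)) (LinearMap.ker p) r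
      (fun k => hP _) hr hdr (fun k => hd _)
    let e := hs.shift (V := V) (subsingleton_ext_of_projective (A := P 0) i)
      (subsingleton_ext_of_projective (A := P 0) (i + 1))
    exact ⟨e.toLinearMap ∘ₗ q, e.surjective.comp hq,
      fun z => (LinearEquiv.map_eq_zero_iff e).trans (hz z)⟩

end ExtOfResolution

section CompleteResolutions

variable {R : Type u} [CommRing R]

lemma HomAcyclic.of_subsingleton_ext [IsNoetherianRing R] {T : ChainComplex (ModuleCat.{u} R) ℤ}
    [∀ i, Module.Projective R (T.X i)] (hT : HomAcyclic T R) (n : ℕ) :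
    ∀ (L : Type u) [AddCommGroup L] [Module R L] [Module.Finite R L],
      (∀ (V : Type u) [AddCommGroup V] [Module R V] (j : ℕ), n < j →
        Subsingleton (EMod R L V j)) → HomAcyclic T L := by
  induction n with
  | zero =>
    intro L _ _ _ hL
    have := projective_of_ext_one fun V _ _ => hL V 1 one_pos
    exact hT.of_projective
  | succ n ih =>
    intro L _ _ _ hL
    obtain ⟨k, g, hg⟩ := exists_cover R L
    exact hg.homAcyclic_right (ih _ fun V _ _ j hj => hg.subsingleton_left
      (subsingleton_ext_of_projective' (by omega)) (hL V (j + 1) (by omega))) hT.of_projective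

/-- The sequence `0 → Zⁱ → Hom(Xᵢ, V) → Zⁱ⁺¹ → 0`. -/
lemma ses_cocyc {X : ChainComplex (ModuleCat.{u} R) ℤ} {V : Type u} [AddCommGroup V] [Module R V]
    {i j : ℤ} (hij : i + 1 = j)
    (hex : ∀ f ∈ cocyc X V j, ∃ g : X.X i →ₗ[R] V, g ∘ₗ (X.d j i).hom = f) :
    SES (cocyc X V i).subtype ((homPre V (X.d j i).hom).codRestrict (cocyc X V j)
      fun g => comp_d_mem_cocyc g) := by
  refine ⟨Subtype.val_injective, fun f => ?_, fun ⟨f, hf⟩ => ?_⟩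
  · refine Subtype.ext_iff.trans ((mem_cocyc hij).symm.trans ⟨fun h => ⟨⟨f, h⟩, rfl⟩, ?_⟩)
    rintro ⟨f, rfl⟩
    exact f.2
  · obtain ⟨g, rfl⟩ := hex f hf
    exact ⟨g, rfl⟩

section Shift

variable {T X : ChainComplex (ModuleCat.{u} R) ℤ} [∀ i, Module.Projective R (T.X i)]
  [∀ i, Module.Projective R (X.X i)] [∀ i, Module.Finite R (X.X i)]

lemma nonempty_homCoh_cocyc_shift (hT : HomAcyclic T R) (q : ℤ)
    (hX : ∀ i j, q ≤ i → i + 1 = j → ∀ f ∈ cocyc X R j,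
      ∃ g : X.X i →ₗ[R] R, g ∘ₗ (X.d j i).hom = f) (r : ℕ) : ∀ p p' q' : ℤ, p' = p + r →
      q' = q + r → Nonempty (HomCoh T (cocyc X R q') p ≃ₗ[R] HomCoh T (cocyc X R q) p') := by
  induction r with
  | zero =>
    rintro p p' q' hp hq
    obtain rfl : p' = p := by simpa using hp
    obtain rfl : q' = q := by simpa using hq
    exact ⟨LinearEquiv.refl R _⟩
  | succ r ih =>
    intro p p' q' hp hq
    obtain ⟨e⟩ := ih (p + 1) p' (q + r) (by push_cast at hp; omega) rfl
    have hij : q + r + 1 = q' := by push_cast at hq; omega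
    obtain ⟨e'⟩ := (ses_cocyc hij (hX _ _ (by omega) hij)).nonempty_homCoh_shift
      (T := T) hT.of_projective (j := p) rfl
    exact ⟨e'.trans e⟩

lemma nonempty_homCoh_cocyc (hT : HomAcyclic T R) (hX : HomAcyclic X R) {p q p' q' : ℤ}
    (h : p + q = p' + q') :
    Nonempty (HomCoh T (cocyc X R q) p ≃ₗ[R] HomCoh T (cocyc X R q') p') := by
  rcases le_total q q' with hq | hq
  · obtain ⟨r, hr⟩ := Int.le.dest hq
    obtain ⟨e⟩ := nonempty_homCoh_cocyc_shift (T := T) hT q (fun i j _ => hX i j) r p' p q'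
      (by omega) (by omega)
    exact ⟨e.symm⟩
  · obtain ⟨r, hr⟩ := Int.le.dest hq
    exact nonempty_homCoh_cocyc_shift (T := T) hT q' (fun i j _ => hX i j) r p p' q
      (by omega) (by omega)

end Shift

section Symmetry

variable {T X : ChainComplex (ModuleCat.{u} R) ℤ}

/-- Transposition of bilinear forms. -/
def flipCocyc (p q : ℤ) : cocyc T (cocyc X R q) p →ₗ[R] (X.X q →ₗ[R] cocyc T R p) where
  toFun F := ((cocyc X R q).subtype ∘ₗ F.1).flip.codRestrict (cocyc T R p) fun y => by
    rw [mem_cocyc rfl]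
    ext x
    have := LinearMap.congr_fun ((mem_cocyc rfl).mp F.2) x
    change (F.1 ((T.d (p + 1) p).hom x)).1 y = 0
    change F.1 ((T.d (p + 1) p).hom x) = 0 at this
    rw [this]; rfl
  map_add' _ _ := rfl
  map_smul' _ _ := rfl

lemma flipCocyc_apply {p q : ℤ} (F : cocyc T (cocyc X R q) p) (y : X.X q) (x : T.X p) :
    (flipCocyc p q F y).1 x = (F.1 x).1 y := rfl

lemma flipCocyc_mem {p q : ℤ} (F : cocyc T (cocyc X R q) p) :
    flipCocyc p q F ∈ cocyc X (cocyc T R p) q := by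
  rw [mem_cocyc rfl]
  ext y x
  exact LinearMap.congr_fun ((mem_cocyc rfl).mp (F.1 x).2) y

lemma exists_bilin [∀ i, Module.Projective R (T.X i)] (hX : HomAcyclic X R) {p q p' q' : ℤ}
    (hq : q' + 1 = q) (F : cocyc T (cocyc X R q) p) :
    (∃ G : T.X p' →ₗ[R] cocyc X R q, G ∘ₗ (T.d p p').hom = F.1) ↔
      ∃ γ : T.X p' →ₗ[R] X.X q' →ₗ[R] R, ∀ x y,
        (F.1 x).1 y = γ ((T.d p p').hom x) ((X.d q q').hom y) := by
  constructor
  · rintro ⟨G, hG⟩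
    obtain ⟨γ, hγ⟩ := Module.projective_lifting_property _ G
      (ses_cocyc (V := R) hq (hX q' q hq)).surj
    refine ⟨γ, fun x y => ?_⟩
    rw [← hG, ← hγ]
    rfl
  · rintro ⟨γ, hγ⟩
    refine ⟨(homPre R (X.d q q').hom).codRestrict (cocyc X R q)
      (fun g => comp_d_mem_cocyc g) ∘ₗ γ, ?_⟩
    ext x y
    exact (hγ x y).symm

lemma flipCocyc_flipCocyc {p q : ℤ} (F : cocyc X (cocyc T R p) q) :
    flipCocyc p q ⟨flipCocyc q p F, flipCocyc_mem F⟩ = F.1 := by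
  ext y x
  rw [flipCocyc_apply, flipCocyc_apply]

lemma exists_flipCocyc_iff [∀ i, Module.Projective R (T.X i)] [∀ i, Module.Projective R (X.X i)]
    (hT : HomAcyclic T R) (hX : HomAcyclic X R) {p q p' q' : ℤ} (hp : p' + 1 = p)
    (hq : q' + 1 = q) (F : cocyc T (cocyc X R q) p) :
    (∃ G : T.X p' →ₗ[R] cocyc X R q, G ∘ₗ (T.d p p').hom = F.1) ↔
      ∃ G : X.X q' →ₗ[R] cocyc T R p, G ∘ₗ (X.d q q').hom = flipCocyc p q F := by
  have h := exists_bilin (p' := q') hT hp ⟨flipCocyc p q F, flipCocyc_mem F⟩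
  rw [exists_bilin hX hq F, h]
  constructor
  · rintro ⟨γ, hγ⟩
    exact ⟨γ.flip, fun y x => hγ x y⟩
  · rintro ⟨γ, hγ⟩
    exact ⟨γ.flip, fun x y => hγ y x⟩

lemma nonempty_homCoh_symm [∀ i, Module.Projective R (T.X i)] [∀ i, Module.Projective R (X.X i)]
    (hT : HomAcyclic T R) (hX : HomAcyclic X R) (p q : ℤ) :
    Nonempty (HomCoh T (cocyc X R q) p ≃ₗ[R] HomCoh X (cocyc T R p) q) :=
  HomCoh.nonempty_equiv_of_span (G := cocyc T (cocyc X R q) p) (sub_add_cancel p 1)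
    (sub_add_cancel q 1) (Submodule.subtype _) (flipCocyc p q) (fun F => F.2) flipCocyc_mem
    (fun f hf => ⟨⟨f, hf⟩, rfl⟩) (fun f hf => ⟨_, flipCocyc_flipCocyc ⟨f, hf⟩⟩)
    (exists_flipCocyc_iff hT hX (sub_add_cancel p 1) (sub_add_cancel q 1))

end Symmetry

end CompleteResolutions

section TateDuality

variable {R : Type u} [CommRing R] {L : Type u} [AddCommGroup L] [Module R L]
  (C : CompleteResolution R (ModuleCat.of R L))

namespace CompleteResolution

instance (i : ℤ) : Module.Projective R (C.T.X i) :=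
  (IsProjective.iff_projective _).mpr (C.projT i)

instance (i : ℤ) : Module.Finite R (C.T.X i) := C.fgT i

instance (i : ℤ) : Module.Projective R (C.P.X i) :=
  (IsProjective.iff_projective _).mpr (C.projP i)

instance (i : ℤ) : Module.Finite R (C.P.X i) := C.fgP i

lemma homAcyclic : HomAcyclic C.T R := by
  intro i j hij f hf
  obtain ⟨g, hg⟩ := (linearYonedaObj_exactAt_iff C.T (ModuleCat.of R R) i j (j + 1)
    (by simp; omega) (by simp)).mp (C.exactTdual j) (ModuleCat.ofHom f) (ModuleCat.hom_ext hf)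
  exact ⟨g.hom, congrArg ModuleCat.Hom.hom hg⟩

lemma subsingleton_P {i : ℤ} (hi : i < 0) : Subsingleton (C.P.X i) :=
  ModuleCat.subsingleton_of_isZero (C.zeroP i hi)

lemma surjective_π : Function.Surjective C.π.hom :=
  (ModuleCat.epi_iff_surjective _).mp C.epiπ

lemma exact_zero : Function.Exact (C.P.d 1 0).hom C.π.hom :=
  (ShortComplex.ShortExact.moduleCat_exact_iff_function_exact _).mp C.exact0

lemma exact_P {i j k : ℤ} (hj : 0 < j) (hij : i + 1 = j) (hjk : j + 1 = k) :
    Function.Exact (C.P.d k j).hom (C.P.d j i).hom :=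
  (ShortComplex.ShortExact.moduleCat_exact_iff_function_exact _).mp
    ((HomologicalComplex.exactAt_iff' C.P k j i (by simpa using hjk) (by simp; omega)).mp
      (C.exactP j hj))

lemma exists_ext (i : ℕ) : ∃ q : cocyc C.P R (i : ℤ) →ₗ[R] EMod R L R i, Function.Surjective q ∧
    ∀ z, q z = 0 ↔ ∃ ψ : C.P.X ((i : ℤ) - 1) →ₗ[R] R, ψ ∘ₗ (C.P.d i ((i : ℤ) - 1)).hom = z.1 := by
  obtain _ | i := i
  · let e := (descEquiv R _ _ C.surjective_π C.exact_zero).symm.trans (extZero L R).symm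
    refine ⟨e.toLinearMap, e.surjective, fun z => (LinearEquiv.map_eq_zero_iff e).trans ?_⟩
    have := C.subsingleton_P (i := ((0 : ℕ) : ℤ) - 1) (by omega)
    constructor
    · rintro rfl
      exact ⟨0, LinearMap.zero_comp _⟩
    · rintro ⟨ψ, hψ⟩
      refine Subtype.ext (hψ.symm.trans ?_)
      rw [Subsingleton.elim ψ 0, LinearMap.zero_comp]; rfl
  · obtain ⟨q, hq, hz⟩ := exists_ext_of_resolution (V := R) i (fun k => C.P.X (k : ℤ))
      (fun k => (C.P.d ((k + 1 : ℕ) : ℤ) (k : ℤ)).hom) L C.π.hom (fun k => inferInstance)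
      C.surjective_π C.exact_zero
      (fun k => C.exact_P (by positivity) (by push_cast; rfl) (by push_cast; rfl))
    let e : cocyc C.P R ((i + 1 : ℕ) : ℤ) ≃ₗ[R]
        LinearMap.ker (homPre R (C.P.d ((i + 1 + 1 : ℕ) : ℤ) ((i + 1 : ℕ) : ℤ)).hom) :=
      LinearEquiv.ofEq _ _ (Submodule.ext fun f => mem_cocyc (by push_cast; rfl))
    refine ⟨q ∘ₗ e.toLinearMap, hq.comp e.surjective, fun z => (hz (e z)).trans ?_⟩
    rw [← mem_cobd (sub_add_cancel _ _), mem_cobd (i := (i : ℤ)) (by push_cast; rfl)]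
    rfl

end CompleteResolution

variable {T : ChainComplex (ModuleCat.{u} R) ℤ} [∀ i, Module.Projective R (T.X i)]

lemma CompleteResolution.homAcyclic_cocyc (hT : HomAcyclic T R) {n : ℕ}
    (hL : ∀ i < n, Subsingleton (EMod R L R i)) (r : ℕ) :
    ∀ q : ℤ, q + 1 = r → r ≤ n → HomAcyclic T (cocyc C.P R q) := by
  induction r with
  | zero =>
    intro q hq _
    have := C.subsingleton_P (i := q) (by simp at hq; omega)
    have : Subsingleton (cocyc C.P R q) :=
      ⟨fun f g => Subtype.ext (LinearMap.ext fun x => by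
        rw [Subsingleton.elim x 0, map_zero, map_zero])⟩
    exact HomAcyclic.of_subsingleton
  | succ r ih =>
    intro q hq hr
    obtain rfl : q = r := by push_cast at hq; omega
    refine (ses_cocyc (V := R) (sub_add_cancel (r : ℤ) 1) fun f hf => ?_).homAcyclic_right
      (ih _ (sub_add_cancel _ _) (by omega)) hT.of_projective
    obtain ⟨q, -, hq⟩ := C.exists_ext r
    exact (hq ⟨f, hf⟩).mp ((hL r (by omega)).elim _ _)

lemma CompleteResolution.nonempty_homCoh_ext (hT : HomAcyclic T R) {n : ℕ}
    (hL : ∀ i < n, Subsingleton (EMod R L R i)) (j : ℤ) :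
    Nonempty (HomCoh T (cocyc C.P R n) j ≃ₗ[R] HomCoh T (EMod R L R n) j) := by
  obtain ⟨q, hq, hz⟩ := C.exists_ext n
  refine (SES.ker q hq).nonempty_homCoh_equiv ?_ j
  let d : (C.P.X ((n : ℤ) - 1) →ₗ[R] R) →ₗ[R] LinearMap.ker q :=
    ((homPre R (C.P.d n ((n : ℤ) - 1)).hom).codRestrict (cocyc C.P R n)
      fun g => comp_d_mem_cocyc g).codRestrict _ fun ψ => (hz _).mpr ⟨ψ, rfl⟩
  have hd : SES (A := cocyc C.P R ((n : ℤ) - 1)) (B := C.P.X ((n : ℤ) - 1) →ₗ[R] R)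
      (C := LinearMap.ker q) (cocyc C.P R ((n : ℤ) - 1)).subtype d := by
    refine ⟨Subtype.val_injective, fun f => ?_, ?_⟩
    · refine Subtype.ext_iff.trans (Subtype.ext_iff.trans
        ((mem_cocyc (sub_add_cancel _ _)).symm.trans ⟨fun h => ⟨⟨f, h⟩, rfl⟩, ?_⟩))
      rintro ⟨f, rfl⟩
      exact f.2
    · rintro ⟨z, hzq⟩
      obtain ⟨ψ, hψ⟩ := (hz z).mp hzq
      exact ⟨ψ, Subtype.ext (Subtype.ext hψ)⟩
  exact hd.homAcyclic_right (C.homAcyclic_cocyc hT hL n _ (sub_add_cancel _ _) le_rfl)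
    hT.of_projective

/-- The cocycles of the duals of `T` and `P` agree in high degrees. -/
lemma CompleteResolution.exists_cocyc_equiv : ∃ n₀ : ℤ, ∀ i, n₀ ≤ i →
    Nonempty (cocyc C.P R i ≃ₗ[R] cocyc C.T R i) := by
  obtain ⟨n₀, h⟩ := C.iso_eventually
  refine ⟨n₀, fun i hi => ?_⟩
  have := h i hi
  have := h (i + 1) (by omega)
  let e : (C.P.X i →ₗ[R] R) ≃ₗ[R] (C.T.X i →ₗ[R] R) :=
    (asIso (C.θ.f i)).toLinearEquiv.symm.congrLeft R R
  have he : ∀ φ, e φ = φ ∘ₗ (C.θ.f i).hom := fun φ => rfl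
  refine ⟨(e.submoduleMap (cocyc C.P R i)).trans (LinearEquiv.ofEq _ _ ?_)⟩
  have hcomm : (C.θ.f i).hom ∘ₗ (C.T.d (i + 1) i).hom =
      (C.P.d (i + 1) i).hom ∘ₗ (C.θ.f (i + 1)).hom := by
    rw [← ModuleCat.hom_comp, ← ModuleCat.hom_comp, C.θ.comm]
  have hsurj : Function.Surjective (C.θ.f (i + 1)).hom :=
    (asIso (C.θ.f (i + 1))).toLinearEquiv.surjective
  ext f
  obtain ⟨φ, rfl⟩ := e.surjective f
  rw [Submodule.mem_map_equiv, e.symm_apply_apply, mem_cocyc rfl, mem_cocyc rfl, he,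
    LinearMap.comp_assoc, hcomm, ← LinearMap.comp_assoc]
  constructor
  · intro h; rw [h, LinearMap.zero_comp]
  · intro h
    rw [← LinearMap.cancel_right hsurj, h, LinearMap.zero_comp]

lemma CompleteResolution.nonempty_homCoh_cocyc_T (hT : HomAcyclic T R) {n : ℕ}
    (hL : ∀ i, i ≠ n → Subsingleton (EMod R L R i)) {j p q : ℤ} (h : p + q = j + n) :
    Nonempty (HomCoh T (EMod R L R n) j ≃ₗ[R] HomCoh T (cocyc C.T R q) p) := by
  obtain ⟨e₁⟩ := C.nonempty_homCoh_ext hT (fun i hi => hL i hi.ne) j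
  obtain ⟨n₀, hn₀⟩ := C.exists_cocyc_equiv
  obtain ⟨r, hr⟩ : ∃ r : ℕ, n₀ ≤ n + r := ⟨(n₀ - n).toNat, by omega⟩
  obtain ⟨e₂⟩ := nonempty_homCoh_cocyc_shift (X := C.P) hT n (fun i k hi hik f hf => by
    obtain ⟨k, rfl⟩ : ∃ l : ℕ, (l : ℤ) = k := ⟨k.toNat, by omega⟩
    obtain ⟨s, -, hs⟩ := C.exists_ext k
    have := (hs ⟨f, hf⟩).mp ((hL k (by omega)).elim _ _)
    rwa [← mem_cobd (sub_add_cancel _ _), mem_cobd hik] at this) r (j - r) j (n + r)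
      (by omega) rfl
  obtain ⟨e₃⟩ := HomCoh.nonempty_congr (T := T) (hn₀ _ hr).some (j - r)
  obtain ⟨e₄⟩ := nonempty_homCoh_cocyc (X := C.T) hT C.homAcyclic
    (show j - r + (n + r) = p + q by omega)
  exact ⟨(e₁.symm.trans e₂.symm).trans (e₃.trans e₄)⟩

lemma CompleteResolution.nonempty_homCoh_of_ses (hT : HomAcyclic T R) {n : ℕ}
    (hL : ∀ i, i ≠ n → Subsingleton (EMod R L R i)) {F N : Type u} [AddCommGroup F] [Module R F]
    [AddCommGroup N] [Module R N] (hF : HomAcyclic T F) {f : EMod R L R n →ₗ[R] F}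
    {g : F →ₗ[R] N} (hfg : SES f g) {j p q : ℤ} (h : p + q = j + n + 1) :
    Nonempty (HomCoh T N j ≃ₗ[R] HomCoh T (cocyc C.T R q) p) := by
  obtain ⟨e₁⟩ := hfg.nonempty_homCoh_shift hF (j := j) rfl
  obtain ⟨e₂⟩ := C.nonempty_homCoh_cocyc_T hT hL (show p + q = j + 1 + n by omega)
  exact ⟨e₁.trans e₂⟩

/-- Tate duality for modules with a single non-vanishing dual. -/
theorem nonempty_tateExt_equiv {M N X Y F G : Type u} [AddCommGroup M] [Module R M]
    [AddCommGroup N] [Module R N] [AddCommGroup X] [Module R X] [AddCommGroup Y] [Module R Y]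
    [AddCommGroup F] [Module R F] [AddCommGroup G] [Module R G]
    (CM : CompleteResolution R (ModuleCat.of R M)) (CY : CompleteResolution R (ModuleCat.of R Y))
    {n m : ℕ} (hM : ∀ i, i ≠ n → Subsingleton (EMod R M R i))
    (hY : ∀ i, i ≠ m → Subsingleton (EMod R Y R i)) (hF : HomAcyclic CY.T F)
    (hG : HomAcyclic CM.T G) {f : EMod R M R n →ₗ[R] F} {g : F →ₗ[R] N} (hfg : SES f g)
    {f' : EMod R Y R m →ₗ[R] G} {g' : G →ₗ[R] X} (hfg' : SES f' g') {i j : ℤ}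
    (hij : j + n = i + m) :
    Nonempty (TateExt R CM (ModuleCat.of R X) i ≃ₗ[R] TateExt R CY (ModuleCat.of R N) j) := by
  obtain ⟨e₁⟩ := nonempty_homology_equiv_homCoh (T := CM.T) X i
  obtain ⟨e₂⟩ := CY.nonempty_homCoh_of_ses CM.homAcyclic hY hG hfg'
    (show i + 1 + m = i + m + 1 by omega)
  obtain ⟨e₃⟩ := nonempty_homCoh_symm CM.homAcyclic CY.homAcyclic (i + 1) m
  obtain ⟨e₄⟩ := CM.nonempty_homCoh_of_ses CY.homAcyclic hM hF hfg
    (show m + (i + 1) = j + n + 1 by omega)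
  obtain ⟨e₅⟩ := nonempty_homology_equiv_homCoh (T := CY.T) N j
  exact ⟨(e₁.trans (e₂.trans e₃)).trans (e₄.symm.trans e₅.symm)⟩

end TateDuality

section LinkedTate

variable {R : Type u} [CommRing R] [IsNoetherianRing R] {a b : Ideal R} [IsLocalRing (R ⧸ a)]
  [IsLocalRing (R ⧸ b)] {M N X Y : Type u}
  [AddCommGroup M] [Module R M] [Module.Finite R M]
  [Module (R ⧸ a) M] [IsScalarTower R (R ⧸ a) M]
  [AddCommGroup N] [Module R N] [Module.Finite R N]
  [Module (R ⧸ a) N] [IsScalarTower R (R ⧸ a) N]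
  [AddCommGroup X] [Module R X] [Module.Finite R X]
  [Module (R ⧸ b) X] [IsScalarTower R (R ⧸ b) X]
  [AddCommGroup Y] [Module R Y] [Module.Finite R Y]
  [Module (R ⧸ b) Y] [IsScalarTower R (R ⧸ b) Y]

/-- Linkage exchanges the arguments of Tate cohomology up to a shift. -/
theorem LinkedBy.nonempty_tateExt_equiv (hR : HasFiniteInjDim R (ModuleCat.of R R))
    (ha₁ : IsGorensteinLocalRing (R ⧸ a)) (ha₂ : IsPerfectIdeal R a)
    (hb₁ : IsGorensteinLocalRing (R ⧸ b)) (hb₂ : IsPerfectIdeal R b) {n m : ℕ}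
    (hMperf : IsGPerfect R (ModuleCat.of R M)) (hMdim : gdim R (ModuleCat.of R M) = (n : ℕ∞))
    (hXperf : IsGPerfect R (ModuleCat.of R X)) (hXdim : gdim R (ModuleCat.of R X) = (m : ℕ∞))
    (hMN : LinkedBy R a M N) (hXY : LinkedBy R b X Y)
    (CM : CompleteResolution R (ModuleCat.of R M)) (CY : CompleteResolution R (ModuleCat.of R Y))
    {i j : ℤ} (hij : j + n = i + m) :
    Nonempty (TateExt R CM (ModuleCat.of R X) i ≃ₗ[R] TateExt R CY (ModuleCat.of R N) j) := by
  obtain ⟨hpa, hM, -, ⟨k, f, g, hfg⟩, -⟩ := hMN.exists_data hR ha₁ ha₂ hMperf hMdim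
  obtain ⟨hpb, -, hY, -, ⟨l, f', g', hfg'⟩⟩ := hXY.exists_data hR hb₁ hb₂ hXperf hXdim
  exact _root_.nonempty_tateExt_equiv CM CY hM hY
    ((CY.homAcyclic.of_subsingleton_ext n (R ⧸ a) hpa).pi k)
    ((CM.homAcyclic.of_subsingleton_ext m (R ⧸ b) hpb).pi l) hfg hfg' hij

end LinkedTate

/-- Let `R` be a Gorenstein local ring, `a`, `b` perfect Gorenstein ideals, `M ∈ CM^n(R)`,
`X ∈ CM^m(R)`, `M ∼_a N` and `X ∼_b Y`. Then for all `i ∈ ℤ`: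
(i) `Êxt^i_R(M,X) ≅ Êxt^{i+m-n}_R(Y,N)`;
(ii) in particular `Êxt^i_R(M,M) ≅ Êxt^i_R(N,N)`;
(iii) if `M` and `X` are self-linked, then `Êxt^i_R(M,X) ≅ Êxt^{i+m-n}_R(X,M)`. -/
theorem stmt_17 (R : Type) [CommRing R] [IsLocalRing R] (hR : IsGorensteinLocalRing R)
    (a b : Ideal R) [IsLocalRing (R ⧸ a)] [IsLocalRing (R ⧸ b)]
    (ha₁ : IsGorensteinLocalRing (R ⧸ a)) (ha₂ : IsPerfectIdeal R a)
    (hb₁ : IsGorensteinLocalRing (R ⧸ b)) (hb₂ : IsPerfectIdeal R b)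
    (M N : Type) [AddCommGroup M] [Module R M] [Module.Finite R M]
    [Module (R ⧸ a) M] [IsScalarTower R (R ⧸ a) M]
    [AddCommGroup N] [Module R N] [Module.Finite R N]
    [Module (R ⧸ a) N] [IsScalarTower R (R ⧸ a) N]
    (X Y : Type) [AddCommGroup X] [Module R X] [Module.Finite R X]
    [Module (R ⧸ b) X] [IsScalarTower R (R ⧸ b) X]
    [AddCommGroup Y] [Module R Y] [Module.Finite R Y]
    [Module (R ⧸ b) Y] [IsScalarTower R (R ⧸ b) Y]
    (n m : ℕ)
    (hMperf : IsGPerfect R (ModuleCat.of R M))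
    (hMdim : gdim R (ModuleCat.of R M) = (n : ℕ∞))
    (hXperf : IsGPerfect R (ModuleCat.of R X))
    (hXdim : gdim R (ModuleCat.of R X) = (m : ℕ∞))
    (hMN : LinkedBy R a M N) (hXY : LinkedBy R b X Y) :
    (∀ (CM : CompleteResolution R (ModuleCat.of R M))
      (CY : CompleteResolution R (ModuleCat.of R Y)) (i : ℤ),
      Nonempty ((TateExt R CM (ModuleCat.of R X) i) ≃ₗ[R]
        (TateExt R CY (ModuleCat.of R N) (i + (m : ℤ) - (n : ℤ))))) ∧
    (∀ (CM : CompleteResolution R (ModuleCat.of R M))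
      (CN : CompleteResolution R (ModuleCat.of R N)) (i : ℤ),
      Nonempty ((TateExt R CM (ModuleCat.of R M) i) ≃ₗ[R]
        (TateExt R CN (ModuleCat.of R N) i))) ∧
    (LinkedBy R a M M → LinkedBy R b X X →
      ∀ (CM : CompleteResolution R (ModuleCat.of R M))
        (CX : CompleteResolution R (ModuleCat.of R X)) (i : ℤ),
        Nonempty ((TateExt R CM (ModuleCat.of R X) i) ≃ₗ[R]
          (TateExt R CX (ModuleCat.of R M) (i + (m : ℤ) - (n : ℤ))))) := by
  have := hR.2.1
  refine ⟨fun CM CY i => ?_, fun CM CN i => ?_, fun hMM hXX CM CX i => ?_⟩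
  · exact LinkedBy.nonempty_tateExt_equiv hR.2.2 ha₁ ha₂ hb₁ hb₂ hMperf hMdim hXperf hXdim
      hMN hXY CM CY (by omega)
  · exact LinkedBy.nonempty_tateExt_equiv hR.2.2 ha₁ ha₂ ha₁ ha₂ hMperf hMdim hMperf hMdim
      hMN hMN CM CN rfl
  · exact LinkedBy.nonempty_tateExt_equiv hR.2.2 ha₁ ha₂ hb₁ hb₂ hMperf hMdim hXperf hXdim
      hMM hXX CM CX (by omega)

end
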